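/- arXiv:0912.3381 — 2 statements merged into one kernel-verified Lean document; each statement's English description precedes it below -/
import Mathlib

section
/- Let (X, μ, T₁, T₂) be an ergodic system and let f be a measurable function with 0 ≤ f ≤ 1. Then for every ε > 0, the set {n ∈ ℤ : ∫ f · (f∘T₁ⁿ) · (f∘T₂ⁿ) dμ > (∫ f dμ)⁴ − ε} is syndetic. -/
open MeasureTheory

/-- A set `E ⊆ ℤ` is syndetic if there is `N > 0` such that every interval
`[M, M+N)` meets `E`. -/
def Syndetic (E : Set ℤ) : Prop :=
  ∃ N : ℤ, 0 < N ∧ ∀ M : ℤ, ∃ n ∈ E, M ≤ n ∧ n < M + N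

local infixr:25 "→ₛ" => SimpleFunc

universe u

/-- The group of permutations of `Y` that are measurable in both directions. -/
def measurablePerm (Y : Type*) [MeasurableSpace Y] : Subgroup (Equiv.Perm Y) where
  carrier := {g | Measurable g ∧ Measurable g.symm}
  mul_mem' hg hh := ⟨hg.1.comp hh.1, hh.2.comp hg.2⟩
  one_mem' := ⟨measurable_id, measurable_id⟩
  inv_mem' hg := ⟨hg.2, hg.1⟩

abbrev MPerm (Y : Type*) [MeasurableSpace Y] := ↥(measurablePerm Y)

section SimpleFunctions

variable {Y : Type*} [MeasurableSpace Y] {β : Type*}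

/-- Composition of a simple function with a measurable permutation. -/
def pre (g : MPerm Y) (F : Y →ₛ β) : Y →ₛ β := F.comp g.1 g.2.1

@[simp] lemma pre_apply (g : MPerm Y) (F : Y →ₛ β) (y : Y) : pre g F y = F (g.1 y) := rfl

lemma pre_pre (g h : MPerm Y) (F : Y →ₛ β) : pre g (pre h F) = pre (h * g) F := rfl

lemma pre_one (F : Y →ₛ β) : pre 1 F = F := rfl

/-- The stabilizer of a simple function, as a subgroup. -/
def fixer (F : Y →ₛ β) : Subgroup (MPerm Y) where
  carrier := {g | pre g F = F}
  mul_mem' {g h} hg hh := by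
    simp only [Set.mem_ofPred_eq] at *
    rw [← pre_pre, hg, hh]
  one_mem' := rfl
  inv_mem' {g} hg := by
    simp only [Set.mem_ofPred_eq] at *
    conv_lhs => rw [← hg]
    rw [pre_pre, mul_inv_cancel, pre_one]

lemma mem_fixer {F : Y →ₛ β} {g : MPerm Y} : g ∈ fixer F ↔ pre g F = F := Iff.rfl

/-- The measurable permutations preserving a functional. -/
def stabilizer (Λ : (Y →ₛ ℝ) →ₗ[ℝ] ℝ) : Subgroup (MPerm Y) where
  carrier := {g | ∀ F, Λ (pre g F) = Λ F}
  mul_mem' {g h} hg hh F := by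
    rw [← pre_pre, hh, hg]
  one_mem' F := rfl
  inv_mem' {g} hg F := by
    rw [← hg (pre g⁻¹ F), pre_pre, inv_mul_cancel, pre_one]

/-- The indicator of the level set `ℓ = k`. -/
noncomputable def level [DecidableEq β] (ℓ : Y →ₛ β) (k : β) : Y →ₛ ℝ :=
  ℓ.map fun x => if x = k then 1 else 0

@[simp] lemma level_apply [DecidableEq β] (ℓ : Y →ₛ β) (k : β) (y : Y) :
    level ℓ k y = if ℓ y = k then 1 else 0 := rfl

lemma sum_simpleFunc_apply {ι : Type*} (s : Finset ι) (F : ι → Y →ₛ ℝ) (y : Y) :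
    (∑ i ∈ s, F i) y = ∑ i ∈ s, F i y := by
  classical
  induction s using Finset.induction_on with
  | empty => rfl
  | insert a s ha ih => rw [Finset.sum_insert ha, Finset.sum_insert ha, ← ih]; rfl

lemma map_eq_sum_level [DecidableEq β] (ℓ : Y →ₛ β) (H : β → ℝ) :
    ℓ.map H = ∑ k ∈ ℓ.range, H k • level ℓ k := by
  ext y
  rw [sum_simpleFunc_apply]
  simp [SimpleFunc.mem_range]

lemma exists_abs_le (F : Y →ₛ ℝ) : ∃ C : ℝ, 0 ≤ C ∧ ∀ y, |F y| ≤ C := by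
  obtain ⟨C, hC⟩ := (F.finite_range.image fun x => |x|).bddAbove
  refine ⟨max C 0, le_max_right _ _, fun y => le_max_of_le_left (hC ⟨F y, ⟨y, rfl⟩, rfl⟩)⟩

end SimpleFunctions

/-- Positive normalized functionals on simple functions. -/
structure IsState {Y : Type*} [MeasurableSpace Y] (Λ : (Y →ₛ ℝ) →ₗ[ℝ] ℝ) : Prop where
  nonneg : ∀ F : Y →ₛ ℝ, (∀ y, 0 ≤ F y) → 0 ≤ Λ F
  map_one : Λ 1 = 1

namespace IsState

variable {Y : Type*} [MeasurableSpace Y] {β : Type*} {Λ : (Y →ₛ ℝ) →ₗ[ℝ] ℝ}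

lemma mono (h : IsState Λ) {F G : Y →ₛ ℝ} (hFG : ∀ y, F y ≤ G y) : Λ F ≤ Λ G := by
  have := h.nonneg (G - F) fun y => by simpa using hFG y
  rw [map_sub] at this
  linarith

lemma const (h : IsState Λ) (c : ℝ) : Λ (c • 1) = c := by
  rw [map_smul, h.map_one, smul_eq_mul, mul_one]

lemma le_of_le (h : IsState Λ) {F : Y →ₛ ℝ} {c : ℝ} (hF : ∀ y, F y ≤ c) : Λ F ≤ c := by
  rw [← h.const c]
  exact h.mono fun y => by simpa using hF y

lemma le_of_ge (h : IsState Λ) {F : Y →ₛ ℝ} {c : ℝ} (hF : ∀ y, c ≤ F y) : c ≤ Λ F := by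
  rw [← h.const c]
  exact h.mono fun y => by simpa using hF y

lemma abs_map_le (h : IsState Λ) {F : Y →ₛ ℝ} {c : ℝ} (hF : ∀ y, |F y| ≤ c) : |Λ F| ≤ c :=
  abs_le.2 ⟨h.le_of_ge fun y => (abs_le.1 (hF y)).1, h.le_of_le fun y => (abs_le.1 (hF y)).2⟩

lemma mul_le (h : IsState Λ) {F G : Y →ₛ ℝ} {θ : ℝ} (hθ : 0 < θ) (hF : Λ (F * F) ≤ θ ^ 2)
    (hG : ∀ y, |G y| ≤ 1) : Λ (F * G) ≤ θ := by
  have h1 : Λ (F * G) ≤ Λ ((1 / (2 * θ)) • (F * F) + (θ / 2) • 1) := by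
    refine h.mono fun y => ?_
    simp only [SimpleFunc.coe_add, SimpleFunc.coe_smul, SimpleFunc.coe_mul, Pi.add_apply,
      Pi.smul_apply, Pi.mul_apply, smul_eq_mul, SimpleFunc.coe_one, Pi.one_apply, mul_one]
    have hg := abs_le.1 (hG y)
    have h2 : G y ^ 2 ≤ 1 := by nlinarith
    have h3 : 1 / (2 * θ) * (F y * F y) + θ / 2 - F y * G y
        = (1 / (2 * θ)) * ((F y - θ * G y) ^ 2 + θ ^ 2 * (1 - G y ^ 2)) := by
      field_simp; ring
    have h4 : 0 ≤ (1 / (2 * θ)) * ((F y - θ * G y) ^ 2 + θ ^ 2 * (1 - G y ^ 2)) := by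
      have := mul_nonneg (sq_nonneg θ) (sub_nonneg.2 h2)
      positivity
    linarith
  rw [map_add, map_smul, h.const, smul_eq_mul] at h1
  have h5 : 1 / (2 * θ) * Λ (F * F) ≤ 1 / (2 * θ) * θ ^ 2 := by gcongr
  have h6 : 1 / (2 * θ) * θ ^ 2 = θ / 2 := by field_simp
  linarith

lemma level_zero [DecidableEq β] (h : IsState Λ) {G : Y →ₛ ℝ} {ℓ : Y →ₛ β} {k : β}
    (hk : Λ (level ℓ k) = 0) : Λ (G * level ℓ k) = 0 := by
  obtain ⟨C, hC0, hC⟩ := exists_abs_le G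
  have key : ∀ c : ℝ, Λ (c • level ℓ k) = 0 := fun c => by rw [map_smul, hk, smul_zero]
  apply le_antisymm
  · rw [← key C]
    refine h.mono fun y => ?_
    have := abs_le.1 (hC y)
    by_cases hy : ℓ y = k <;> simp [hy]; linarith
  · rw [← key (-C)]
    refine h.mono fun y => ?_
    have := abs_le.1 (hC y)
    by_cases hy : ℓ y = k <;> simp [hy]; linarith

end IsState

section ConditionalExpectation

variable {Y : Type*} [MeasurableSpace Y] {β : Type*} [DecidableEq β] {Λ : (Y →ₛ ℝ) →ₗ[ℝ] ℝ}

/-- The conditional expectation of `f` given `ℓ`, as a function of the value of `ℓ`. -/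
noncomputable def condVal (Λ : (Y →ₛ ℝ) →ₗ[ℝ] ℝ) (f : Y →ₛ ℝ) (ℓ : Y →ₛ β) (k : β) : ℝ :=
  Λ (f * level ℓ k) / Λ (level ℓ k)

/-- The conditional expectation of `f` given the label `ℓ`. -/
noncomputable def cexp (Λ : (Y →ₛ ℝ) →ₗ[ℝ] ℝ) (f : Y →ₛ ℝ) (ℓ : Y →ₛ β) : Y →ₛ ℝ :=
  ℓ.map (condVal Λ f ℓ)

/-- The squared distance of `f` to its conditional expectation. -/
noncomputable def dev (Λ : (Y →ₛ ℝ) →ₗ[ℝ] ℝ) (f : Y →ₛ ℝ) (ℓ : Y →ₛ β) : ℝ :=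
  Λ ((f - cexp Λ f ℓ) * (f - cexp Λ f ℓ))

lemma level_nonneg (h : IsState Λ) (ℓ : Y →ₛ β) (k : β) : 0 ≤ Λ (level ℓ k) :=
  h.nonneg _ fun y => by rw [level_apply]; split_ifs <;> norm_num

lemma condVal_nonneg (h : IsState Λ) {f : Y →ₛ ℝ} (hf : ∀ y, 0 ≤ f y) (ℓ : Y →ₛ β) (k : β) :
    0 ≤ condVal Λ f ℓ k := by
  refine div_nonneg (h.nonneg _ fun y => ?_) (level_nonneg h ℓ k)
  by_cases hy : ℓ y = k <;> simp [hy, hf]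

lemma condVal_le_one (h : IsState Λ) {f : Y →ₛ ℝ} (hf : ∀ y, f y ≤ 1) (ℓ : Y →ₛ β) (k : β) :
    condVal Λ f ℓ k ≤ 1 := by
  refine div_le_one_of_le₀ (h.mono fun y => ?_) (level_nonneg h ℓ k)
  by_cases hy : ℓ y = k <;> simp [hy, hf]

lemma cexp_orthogonal (h : IsState Λ) (f : Y →ₛ ℝ) (ℓ : Y →ₛ β) (H : β → ℝ) :
    Λ ((f - cexp Λ f ℓ) * ℓ.map H) = 0 := by
  rw [map_eq_sum_level, Finset.mul_sum, map_sum]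
  refine Finset.sum_eq_zero fun k _ => ?_
  rw [mul_smul_comm, map_smul]
  have h1 : (f - cexp Λ f ℓ) * level ℓ k
      = f * level ℓ k - condVal Λ f ℓ k • level ℓ k := by
    ext y
    by_cases hy : ℓ y = k <;> simp [hy, cexp]
  rw [h1, map_sub, map_smul, smul_eq_mul, condVal]
  rcases eq_or_ne (Λ (level ℓ k)) 0 with h0 | h0
  · rw [h.level_zero h0, h0]; simp
  · rw [smul_eq_mul, div_mul_cancel₀ _ h0]; simp

lemma dev_pythagoras (h : IsState Λ) (f : Y →ₛ ℝ) (ℓ : Y →ₛ β) (H : β → ℝ) :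
    Λ ((f - ℓ.map H) * (f - ℓ.map H))
      = dev Λ f ℓ + Λ ((cexp Λ f ℓ - ℓ.map H) * (cexp Λ f ℓ - ℓ.map H)) := by
  have h1 : (f - ℓ.map H) * (f - ℓ.map H)
      = (f - cexp Λ f ℓ) * (f - cexp Λ f ℓ)
        + (cexp Λ f ℓ - ℓ.map H) * (cexp Λ f ℓ - ℓ.map H)
        + (2 : ℝ) • ((f - cexp Λ f ℓ) * ℓ.map (fun k => condVal Λ f ℓ k - H k)) := by
    ext y
    simp [cexp]; ring
  rw [h1, map_add, map_add, map_smul, cexp_orthogonal h, dev]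
  simp

lemma dev_nonneg (h : IsState Λ) (f : Y →ₛ ℝ) (ℓ : Y →ₛ β) : 0 ≤ dev Λ f ℓ :=
  h.nonneg _ fun _ => mul_self_nonneg _

lemma dev_le (h : IsState Λ) (f : Y →ₛ ℝ) (ℓ : Y →ₛ β) (H : β → ℝ) :
    dev Λ f ℓ ≤ Λ ((f - ℓ.map H) * (f - ℓ.map H)) := by
  rw [dev_pythagoras h f ℓ H]
  linarith [h.nonneg ((cexp Λ f ℓ - ℓ.map H) * (cexp Λ f ℓ - ℓ.map H)) fun _ => mul_self_nonneg _]

/-- A correlation with functions of the label improves the approximation. -/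
lemma dev_le_sub_sq (h : IsState Λ) (f : Y →ₛ ℝ) (ℓ : Y →ₛ β) (H V : β → ℝ)
    (hV : ∀ y, |V (ℓ y)| ≤ 1) {c : ℝ} (hc : 0 ≤ c)
    (hcor : Λ ((f - ℓ.map H) * ℓ.map V) ≤ -c) :
    dev Λ f ℓ ≤ Λ ((f - ℓ.map H) * (f - ℓ.map H)) - c ^ 2 := by
  refine (dev_le h f ℓ fun k => H k - c * V k).trans ?_
  have h1 : (f - ℓ.map (fun k => H k - c * V k)) * (f - ℓ.map (fun k => H k - c * V k))
      = (f - ℓ.map H) * (f - ℓ.map H) + (2 * c) • ((f - ℓ.map H) * ℓ.map V)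
        + c ^ 2 • (ℓ.map V * ℓ.map V) := by
    ext y; simp; ring
  rw [h1, map_add, map_add, map_smul, map_smul, smul_eq_mul, smul_eq_mul]
  have h2 : Λ (ℓ.map V * ℓ.map V) ≤ 1 := h.le_of_le fun y => by
    have := abs_le.1 (hV y)
    simp; nlinarith
  nlinarith [mul_le_mul_of_nonneg_left h2 (sq_nonneg c), mul_le_mul_of_nonneg_left hcor hc]

end ConditionalExpectation

section LowerBound

variable {Y : Type*} [MeasurableSpace Y] {β : Type*} [DecidableEq β] {Λ : (Y →ₛ ℝ) →ₗ[ℝ] ℝ}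

lemma map_mul_comp_label (h : IsState Λ) (f : Y →ₛ ℝ) (ℓ : Y →ₛ β) (H : β → ℝ) :
    Λ (f * ℓ.map H) = Λ (cexp Λ f ℓ * ℓ.map H) := by
  rw [← sub_eq_zero, ← map_sub, ← sub_mul, cexp_orthogonal h]

lemma map_mul_inv_cexp_le (h : IsState Λ) (f : Y →ₛ ℝ) (ℓ : Y →ₛ β) :
    Λ (f * ℓ.map fun k => (condVal Λ f ℓ k)⁻¹) ≤ 1 := by
  rw [map_mul_comp_label h]
  exact h.le_of_le fun y => by simpa [cexp] using mul_inv_le_one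

lemma map_mul_zero_cexp (h : IsState Λ) (f : Y →ₛ ℝ) (ℓ : Y →ₛ β) :
    Λ (f * ℓ.map fun k => if condVal Λ f ℓ k = 0 then 1 else 0) = 0 := by
  rw [map_mul_comp_label h]
  convert Λ.map_zero
  ext y
  simp [cexp]

lemma four_le_of_prod_inv {p q r : ℝ} (hp : 0 < p) (hq : 0 < q) (hr : 0 < r) :
    4 ≤ (p * q * r)⁻¹ + p + q + r := by
  have h1 := Real.log_le_sub_one_of_pos hp
  have h2 := Real.log_le_sub_one_of_pos hq
  have h3 := Real.log_le_sub_one_of_pos hr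
  have h4 := Real.log_le_sub_one_of_pos (inv_pos.2 (mul_pos (mul_pos hp hq) hr))
  rw [Real.log_inv, Real.log_mul (by positivity) hr.ne', Real.log_mul hp.ne' hq.ne'] at h4
  linarith

lemma four_mul_cube_le {α x y z : ℝ} (hα : 0 < α) (hx : 0 < x) (hy : 0 < y) (hz : 0 < z) :
    4 * α ^ 3 ≤ x * y * z + α ^ 4 * (x⁻¹ + y⁻¹ + z⁻¹) := by
  have h := four_le_of_prod_inv (div_pos hα hx) (div_pos hα hy) (div_pos hα hz)
  have h2 := mul_le_mul_of_nonneg_left h (pow_pos hα 3).le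
  have h3 : α ^ 3 * ((α / x * (α / y) * (α / z))⁻¹ + α / x + α / y + α / z)
      = x * y * z + α ^ 4 * (x⁻¹ + y⁻¹ + z⁻¹) := by
    field_simp
    ring
  linarith

lemma pointwise_lower_bound {α t x y z : ℝ} (hα : 0 < α) (ht : 0 ≤ t) (hx : 0 ≤ x) (hy : 0 ≤ y)
    (hz : 0 ≤ z) :
    4 * α ^ 3 * t - α ^ 4 * (t * x⁻¹ + t * y⁻¹ + t * z⁻¹)
      - 4 * α ^ 3 * (t * (if x = 0 then 1 else 0) + t * (if y = 0 then 1 else 0)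
        + t * (if z = 0 then 1 else 0)) ≤ t * (x * y * z) := by
  have h3 : 0 ≤ α ^ 3 * t := by positivity
  have h4 : 0 ≤ α ^ 4 * (t * x⁻¹ + t * y⁻¹ + t * z⁻¹) := by positivity
  have h5 : 0 ≤ t * (x * y * z) := by positivity
  by_cases hx0 : x = 0
  · have : 0 ≤ t * (if y = 0 then (1 : ℝ) else 0) + t * (if z = 0 then (1 : ℝ) else 0) := by
      positivity
    rw [if_pos hx0]
    nlinarith [mul_nonneg (pow_pos hα 3).le this]
  by_cases hy0 : y = 0
  · have : 0 ≤ t * (if x = 0 then (1 : ℝ) else 0) + t * (if z = 0 then (1 : ℝ) else 0) := by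
      positivity
    rw [if_pos hy0]
    nlinarith [mul_nonneg (pow_pos hα 3).le this]
  by_cases hz0 : z = 0
  · have : 0 ≤ t * (if x = 0 then (1 : ℝ) else 0) + t * (if y = 0 then (1 : ℝ) else 0) := by
      positivity
    rw [if_pos hz0]
    nlinarith [mul_nonneg (pow_pos hα 3).le this]
  rw [if_neg hx0, if_neg hy0, if_neg hz0]
  have := four_mul_cube_le hα (hx.lt_of_ne' hx0) (hy.lt_of_ne' hy0) (hz.lt_of_ne' hz0)
  nlinarith [mul_le_mul_of_nonneg_left this ht]

/-- The triple product of conditional expectations is at least the fourth power of the mean. -/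
lemma pow_four_le_map_cexp {β₀ β₁ β₂ : Type*} [DecidableEq β₀] [DecidableEq β₁] [DecidableEq β₂]
    (h : IsState Λ) {f : Y →ₛ ℝ} (f0 : ∀ y, 0 ≤ f y) (f1 : ∀ y, f y ≤ 1)
    (ℓ₀ : Y →ₛ β₀) (ℓ₁ : Y →ₛ β₁) (ℓ₂ : Y →ₛ β₂) :
    Λ f ^ 4 ≤ Λ (cexp Λ f ℓ₀ * cexp Λ f ℓ₁ * cexp Λ f ℓ₂) := by
  have p0 : ∀ y, 0 ≤ cexp Λ f ℓ₀ y := fun y => condVal_nonneg h f0 _ _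
  have p1 : ∀ y, 0 ≤ cexp Λ f ℓ₁ y := fun y => condVal_nonneg h f0 _ _
  have p2 : ∀ y, 0 ≤ cexp Λ f ℓ₂ y := fun y => condVal_nonneg h f0 _ _
  have hprod : ∀ y, 0 ≤ cexp Λ f ℓ₀ y * cexp Λ f ℓ₁ y * cexp Λ f ℓ₂ y := fun y =>
    mul_nonneg (mul_nonneg (p0 y) (p1 y)) (p2 y)
  rcases (h.nonneg f f0).eq_or_lt with hα | hα
  · rw [← hα]
    simpa using h.nonneg _ hprod
  have h1 : Λ (f * (cexp Λ f ℓ₀ * cexp Λ f ℓ₁ * cexp Λ f ℓ₂))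
      ≤ Λ (cexp Λ f ℓ₀ * cexp Λ f ℓ₁ * cexp Λ f ℓ₂) :=
    h.mono fun y => mul_le_of_le_one_left (hprod y) (f1 y)
  refine le_trans ?_ h1
  have h2 := h.mono (G := f * (cexp Λ f ℓ₀ * cexp Λ f ℓ₁ * cexp Λ f ℓ₂))
    (F := (4 * Λ f ^ 3) • f - Λ f ^ 4 • (f * (ℓ₀.map fun k => (condVal Λ f ℓ₀ k)⁻¹)
      + f * (ℓ₁.map fun k => (condVal Λ f ℓ₁ k)⁻¹) + f * (ℓ₂.map fun k => (condVal Λ f ℓ₂ k)⁻¹))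
      - (4 * Λ f ^ 3) • (f * (ℓ₀.map fun k => if condVal Λ f ℓ₀ k = 0 then 1 else 0)
      + f * (ℓ₁.map fun k => if condVal Λ f ℓ₁ k = 0 then 1 else 0)
      + f * (ℓ₂.map fun k => if condVal Λ f ℓ₂ k = 0 then 1 else 0)))
    fun y => pointwise_lower_bound hα (f0 y) (p0 y) (p1 y) (p2 y)
  refine le_trans ?_ h2
  simp only [map_sub, map_add, map_smul, smul_eq_mul, map_mul_zero_cexp h]
  have e0 := map_mul_inv_cexp_le h f ℓ₀
  have e1 := map_mul_inv_cexp_le h f ℓ₁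
  have e2 := map_mul_inv_cexp_le h f ℓ₂
  nlinarith [mul_le_mul_of_nonneg_left (add_le_add (add_le_add e0 e1) e2) (pow_pos hα 4).le]

end LowerBound

section UltrafilterLimit

open Filter Topology

/-- Pointwise bounded sequences of functionals have limits along ultrafilters. -/
lemma exists_ultrafilter_limit {V : Type*} [AddCommGroup V] [Module ℝ V] (U : Ultrafilter ℕ)
    (L : ℕ → V →ₗ[ℝ] ℝ) (hL : ∀ v, ∃ C, ∀ N, |L N v| ≤ C) :
    ∃ M : V →ₗ[ℝ] ℝ, ∀ v, Tendsto (fun N => L N v) U (𝓝 (M v)) := by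
  have key : ∀ v, ∃ x : ℝ, Tendsto (fun N => L N v) U (𝓝 x) := by
    intro v
    obtain ⟨C, hC⟩ := hL v
    obtain ⟨x, -, hx⟩ := (isCompact_Icc (a := -C) (b := C)).ultrafilter_le_nhds
      (U.map fun N => L N v) (by
        rw [Ultrafilter.coe_map, le_principal_iff, mem_map]
        exact Filter.Eventually.of_forall fun N => abs_le.1 (hC N))
    exact ⟨x, hx⟩
  choose M hM using key
  exact ⟨{ toFun := M
           map_add' := fun v w => tendsto_nhds_unique (hM (v + w)) (by
            simpa only [map_add] using (hM v).add (hM w))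
           map_smul' := fun c v => tendsto_nhds_unique (hM (c • v)) (by
            simpa only [map_smul, smul_eq_mul, RingHom.id_apply] using (hM v).const_mul c) }, hM⟩

end UltrafilterLimit

section Rigidity

open Filter Topology

variable {X : Type*} [MeasurableSpace X]

/-- The functional on simple functions given by integration. -/
noncomputable def integralFunctional (μ : Measure X) [IsFiniteMeasure μ] : (X →ₛ ℝ) →ₗ[ℝ] ℝ where
  toFun F := ∫ x, F x ∂μ
  map_add' F G := integral_add (F.integrable_of_isFiniteMeasure) (G.integrable_of_isFiniteMeasure)
  map_smul' c _ := integral_const_mul c _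

lemma integralFunctional_apply (μ : Measure X) [IsFiniteMeasure μ] (F : X →ₛ ℝ) :
    integralFunctional μ F = ∫ x, F x ∂μ := rfl

lemma isState_integralFunctional (μ : Measure X) [IsProbabilityMeasure μ] :
    IsState (integralFunctional μ) where
  nonneg F hF := integral_nonneg hF
  map_one := by simp [integralFunctional_apply]

/-- The indicator of a measurable set as a simple function. -/
noncomputable def simpleIndicator (A : Set X) (hA : MeasurableSet A) : X →ₛ ℝ :=
  SimpleFunc.piecewise A hA 1 0

lemma simpleIndicator_apply (A : Set X) (hA : MeasurableSet A) (x : X) [Decidable (x ∈ A)] :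
    simpleIndicator A hA x = if x ∈ A then 1 else 0 := by
  classical
  simp [simpleIndicator, Set.piecewise]

lemma integralFunctional_indicator (μ : Measure X) [IsFiniteMeasure μ] (A : Set X)
    (hA : MeasurableSet A) : integralFunctional μ (simpleIndicator A hA) = μ.real A := by
  classical
  rw [integralFunctional_apply, ← integral_indicator_one hA]
  congr 1

lemma simpleIndicator_nonneg (A : Set X) (hA : MeasurableSet A) (x : X) :
    0 ≤ simpleIndicator A hA x := by
  classical
  rw [simpleIndicator_apply]; positivity

lemma pre_simpleIndicator (g : MPerm X) (A : Set X) (hA : MeasurableSet A) :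
    pre g (simpleIndicator A hA) = simpleIndicator (g.1 ⁻¹' A) (g.2.1 hA) := by
  classical
  ext x
  simp [simpleIndicator_apply]

lemma hasSum_map_simpleIndicator {μ : Measure X} [IsFiniteMeasure μ] {L : (X →ₛ ℝ) →ₗ[ℝ] ℝ}
    (hL0 : ∀ F : X →ₛ ℝ, (∀ x, 0 ≤ F x) → 0 ≤ L F) {C : ℝ}
    (hLC : ∀ F : X →ₛ ℝ, (∀ x, 0 ≤ F x) → L F ≤ C * integralFunctional μ F)
    (A : ℕ → Set X) (hA : ∀ i, MeasurableSet (A i)) (hd : Pairwise (Function.onFun Disjoint A)) :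
    HasSum (fun i => L (simpleIndicator (A i) (hA i)))
      (L (simpleIndicator (⋃ i, A i) (MeasurableSet.iUnion hA))) := by
  classical
  rw [hasSum_iff_tendsto_nat_of_nonneg fun i => hL0 _ (simpleIndicator_nonneg _ _)]
  have hμ : Tendsto (fun n => ∑ i ∈ Finset.range n,
      integralFunctional μ (simpleIndicator (A i) (hA i))) atTop
      (𝓝 (integralFunctional μ (simpleIndicator (⋃ i, A i) (MeasurableSet.iUnion hA)))) := by
    simp only [integralFunctional_indicator]
    have h := ENNReal.tendsto_toReal (measure_ne_top μ (⋃ i, A i))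
    rw [measure_iUnion hd hA] at h
    have h2 := h.comp (ENNReal.summable (f := fun i => μ (A i))).hasSum.tendsto_sum_nat
    rw [measureReal_def, measure_iUnion hd hA]
    refine h2.congr fun n => ?_
    exact ENNReal.toReal_sum fun i _ => measure_ne_top μ _
  set W := simpleIndicator (⋃ i, A i) (MeasurableSet.iUnion hA)
  have hR : ∀ n x, 0 ≤ (W - ∑ i ∈ Finset.range n, simpleIndicator (A i) (hA i)) x := by
    intro n x
    rw [SimpleFunc.coe_sub, Pi.sub_apply, sum_simpleFunc_apply, sub_nonneg]
    by_cases hx : ∃ j, x ∈ A j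
    · obtain ⟨j, hj⟩ := hx
      have h1 : W x = 1 := by
        rw [simpleIndicator_apply, if_pos (Set.mem_iUnion.2 ⟨j, hj⟩)]
      rw [h1]
      calc ∑ i ∈ Finset.range n, simpleIndicator (A i) (hA i) x
          ≤ ∑ i ∈ Finset.range n, if i = j then 1 else 0 := by
            refine Finset.sum_le_sum fun i _ => ?_
            rw [simpleIndicator_apply]
            split_ifs with h2 h3
            · exact le_rfl
            · exact absurd hj (Set.disjoint_left.1 (hd h3) h2)
            · norm_num
            · exact le_rfl
        _ ≤ 1 := by
            rw [Finset.sum_ite_eq']; split_ifs <;> norm_num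
    · push Not at hx
      rw [Finset.sum_eq_zero fun i _ => by rw [simpleIndicator_apply, if_neg (hx i)]]
      exact simpleIndicator_nonneg _ _ _
  have hlim : Tendsto (fun n => L W - ∑ i ∈ Finset.range n, L (simpleIndicator (A i) (hA i)))
      atTop (𝓝 0) := by
    refine tendsto_of_tendsto_of_tendsto_of_le_of_le (g := fun _ => 0)
      (h := fun n => C * (integralFunctional μ W - ∑ i ∈ Finset.range n,
        integralFunctional μ (simpleIndicator (A i) (hA i)))) tendsto_const_nhds ?_ ?_ ?_
    · simpa using ((tendsto_const_nhds (x := integralFunctional μ W)).sub hμ).const_mul C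
    · intro n
      simpa only [map_sub, map_sum] using hL0 _ (hR n)
    · intro n
      simpa only [map_sub, map_sum] using hLC _ (hR n)
  simpa using (tendsto_const_nhds (x := L W)).sub hlim

/-- The measure represented by a functional dominated by an integral. -/
lemma exists_representing_measure {μ : Measure X} [IsFiniteMeasure μ] {L : (X →ₛ ℝ) →ₗ[ℝ] ℝ}
    (hL0 : ∀ F : X →ₛ ℝ, (∀ x, 0 ≤ F x) → 0 ≤ L F) {C : ℝ}
    (hLC : ∀ F : X →ₛ ℝ, (∀ x, 0 ≤ F x) → L F ≤ C * integralFunctional μ F) :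
    ∃ m : Measure X, ∀ A (hA : MeasurableSet A),
      m A = ENNReal.ofReal (L (simpleIndicator A hA)) := by
  classical
  refine ⟨Measure.ofMeasurable (fun A hA => ENNReal.ofReal (L (simpleIndicator A hA))) ?_ ?_, ?_⟩
  · have : simpleIndicator (∅ : Set X) MeasurableSet.empty = 0 := by
      ext x; simp [simpleIndicator_apply]
    simp [this]
  · intro A hA hd
    have h := hasSum_map_simpleIndicator hL0 hLC A hA hd
    rw [← h.tsum_eq, ENNReal.ofReal_tsum_of_nonneg
      (fun i => hL0 _ (simpleIndicator_nonneg _ _)) h.summable]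
  · intro A hA
    exact Measure.ofMeasurable_apply A hA

lemma measurePreserving_of_map_indicator {m : Measure X} {L : (X →ₛ ℝ) →ₗ[ℝ] ℝ}
    (hm : ∀ A (hA : MeasurableSet A), m A = ENNReal.ofReal (L (simpleIndicator A hA)))
    {g : MPerm X} (hg : g ∈ stabilizer L) : MeasurePreserving g.1 m m := by
  refine ⟨g.2.1, ?_⟩
  ext A hA
  rw [Measure.map_apply g.2.1 hA, hm _ hA, hm _ (g.2.1 hA), ← pre_simpleIndicator, hg]

lemma measure_eq_ofReal_integralFunctional (μ : Measure X) [IsFiniteMeasure μ] (A : Set X)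
    (hA : MeasurableSet A) :
    μ A = ENNReal.ofReal (integralFunctional μ (simpleIndicator A hA)) := by
  rw [integralFunctional_indicator, ofReal_measureReal]

/-- A function that is almost everywhere invariant under all `S ^ i * T ^ j` is almost everywhere
constant when strictly invariant sets are trivial. -/
lemma ae_const_of_ae_invariant {μ : Measure X} [IsProbabilityMeasure μ] {S T : MPerm X}
    (hcomm : S * T = T * S)
    (herg : ∀ s : Set X, MeasurableSet s → S.1 ⁻¹' s = s → T.1 ⁻¹' s = s → μ s = 0 ∨ μ s = 1)
    {r : X → ENNReal} (hr : Measurable r)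
    (hinv : ∀ i j : ℤ, (fun x => r ((S ^ i * T ^ j).1 x)) =ᵐ[μ] r) :
    ∃ c, r =ᵐ[μ] Function.const X c := by
  let r' : X → ENNReal := fun x => ⨆ p : ℤ × ℤ, r ((S ^ p.1 * T ^ p.2).1 x)
  have hr' : Measurable r' := Measurable.iSup fun p => hr.comp (S ^ p.1 * T ^ p.2).2.1
  have heq : r' =ᵐ[μ] r := by
    have : ∀ᵐ x ∂μ, ∀ p : ℤ × ℤ, r ((S ^ p.1 * T ^ p.2).1 x) = r x :=
      ae_all_iff.2 fun p => hinv p.1 p.2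
    filter_upwards [this] with x hx
    simp only [r', hx, iSup_const]
  have hS : ∀ x, r' (S.1 x) = r' x := by
    intro x
    refine (Equiv.iSup_congr ((Equiv.addRight (1 : ℤ)).prodCongr (Equiv.refl ℤ)) fun p => ?_)
    have : S ^ (p.1 + 1) * T ^ p.2 = S ^ p.1 * T ^ p.2 * S := by
      rw [zpow_add_one, mul_assoc, mul_assoc]
      congr 1
      exact (Commute.zpow_right (show Commute S T from hcomm) p.2).eq
    change r ((S ^ (p.1 + 1) * T ^ p.2).1 x) = _
    rw [this]; rfl
  have hT : ∀ x, r' (T.1 x) = r' x := by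
    intro x
    refine (Equiv.iSup_congr ((Equiv.refl ℤ).prodCongr (Equiv.addRight (1 : ℤ))) fun p => ?_)
    change r ((S ^ p.1 * T ^ (p.2 + 1)).1 x) = _
    rw [zpow_add_one, ← mul_assoc]; rfl
  obtain ⟨c, hc⟩ := exists_eventuallyEq_const_of_forall_separating (f := r') (l := ae μ)
    MeasurableSet fun U hU => by
      have hm := hr' hU
      rcases herg (r' ⁻¹' U) hm (by ext x; simp [hS]) (by ext x; simp [hT]) with h | h
      · right
        exact measure_eq_zero_iff_ae_notMem.1 h
      · left
        exact (prob_compl_eq_zero_iff hm).2 h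
  exact ⟨c, heq.symm.trans hc⟩

/-- In an ergodic system, an invariant functional dominated by the integral is a multiple of it. -/
lemma eq_mul_integralFunctional {μ : Measure X} [IsProbabilityMeasure μ] {S T : MPerm X}
    (hcomm : S * T = T * S) (hS : S ∈ stabilizer (integralFunctional μ))
    (hT : T ∈ stabilizer (integralFunctional μ))
    (herg : ∀ s : Set X, MeasurableSet s → S.1 ⁻¹' s = s → T.1 ⁻¹' s = s → μ s = 0 ∨ μ s = 1)
    {L : (X →ₛ ℝ) →ₗ[ℝ] ℝ} (hL0 : ∀ F : X →ₛ ℝ, (∀ x, 0 ≤ F x) → 0 ≤ L F) {C : ℝ}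
    (hLC : ∀ F : X →ₛ ℝ, (∀ x, 0 ≤ F x) → L F ≤ C * integralFunctional μ F)
    (hLS : S ∈ stabilizer L) (hLT : T ∈ stabilizer L) (F : X →ₛ ℝ) :
    L F = L 1 * integralFunctional μ F := by
  classical
  obtain ⟨m, hm⟩ := exists_representing_measure hL0 hLC
  have hone : simpleIndicator (Set.univ : Set X) MeasurableSet.univ = 1 := by
    ext x; simp [simpleIndicator_apply]
  have hfin : IsFiniteMeasure m := ⟨by rw [hm _ MeasurableSet.univ]; exact ENNReal.ofReal_lt_top⟩
  have hac : m ≪ μ := by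
    refine Measure.AbsolutelyContinuous.mk fun A hA h0 => ?_
    rw [hm A hA, ENNReal.ofReal_eq_zero]
    have := hLC (simpleIndicator A hA) (simpleIndicator_nonneg _ _)
    rwa [integralFunctional_indicator, measureReal_def, h0, ENNReal.toReal_zero, mul_zero] at this
  obtain ⟨c, hc⟩ := ae_const_of_ae_invariant hcomm herg (Measure.measurable_rnDeriv m μ)
    fun i j => (measurePreserving_of_map_indicator hm
      (mul_mem (zpow_mem hLS i) (zpow_mem hLT j))).rnDeriv_comp_aeEq
      (measurePreserving_of_map_indicator (measure_eq_ofReal_integralFunctional μ)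
      (mul_mem (zpow_mem hS i) (zpow_mem hT j)))
  have hcm : ∀ A, m A = c * μ A := by
    intro A
    conv_lhs => rw [← Measure.withDensity_rnDeriv_eq m μ hac, withDensity_congr_ae hc]
    change μ.withDensity (fun _ => c) A = _
    simp [withDensity_const]
  have hind : ∀ A (hA : MeasurableSet A), L (simpleIndicator A hA)
      = L 1 * integralFunctional μ (simpleIndicator A hA) := by
    intro A hA
    have h1 := hm A hA
    have h2 := hm _ MeasurableSet.univ
    rw [hone, hcm, measure_univ, mul_one] at h2
    rw [hcm, h2] at h1
    have h3 := congrArg ENNReal.toReal h1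
    have p1 : 0 ≤ L 1 := hL0 _ fun x => by simp
    rw [ENNReal.toReal_mul, ENNReal.toReal_ofReal p1,
      ENNReal.toReal_ofReal (hL0 _ (simpleIndicator_nonneg _ _))] at h3
    rw [integralFunctional_indicator, ← h3, measureReal_def]
  have hF : F = F.map id := by ext x; simp
  have hlev : ∀ k, level F k = simpleIndicator (F ⁻¹' {k}) (F.measurableSet_fiber k) := by
    intro k; ext x; simp [simpleIndicator_apply]
  rw [hF, map_eq_sum_level, map_sum, map_sum, Finset.mul_sum]
  refine Finset.sum_congr rfl fun k _ => ?_
  rw [map_smul, map_smul, hlev, hind]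
  simp only [smul_eq_mul]; ring

end Rigidity

section Averages

open Filter Topology

lemma abs_sum_sub_sum_shift_le {x y : ℕ → ℝ} {C : ℝ} (hx : ∀ n, |x n| ≤ C)
    (hxy : ∀ n, x (n + 1) = y n) (N : ℕ) :
    |∑ n ∈ Finset.range N, x n - ∑ n ∈ Finset.range N, y n| ≤ 2 * C := by
  have h1 := Finset.sum_range_succ x N
  rw [Finset.sum_range_succ'] at h1
  simp only [hxy] at h1
  have h2 : ∑ n ∈ Finset.range N, x n - ∑ n ∈ Finset.range N, y n = x 0 - x N := by linarith
  rw [h2]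
  have := abs_le.1 (hx 0)
  have := abs_le.1 (hx N)
  exact abs_le.2 ⟨by linarith, by linarith⟩

variable {Y : Type*} [MeasurableSpace Y]

lemma pre_mul (g : MPerm Y) (F G : Y →ₛ ℝ) : pre g (F * G) = pre g F * pre g G := rfl

/-- Averaging a multiplier that is invariant under `S * T⁻¹` along the orbit of `T`. -/
lemma exists_average {S T : MPerm Y} (hcomm : S * T = T * S) {M : (Y →ₛ ℝ) →ₗ[ℝ] ℝ}
    (hM : IsState M) (hS : S ∈ stabilizer M) (hT : T ∈ stabilizer M) {θ : Y →ₛ ℝ}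
    (hθ : pre S θ = pre T θ) (h0 : ∀ y, 0 ≤ θ y) (h1 : ∀ y, θ y ≤ 1) :
    ∃ L : (Y →ₛ ℝ) →ₗ[ℝ] ℝ, (∀ F : Y →ₛ ℝ, (∀ y, 0 ≤ F y) → 0 ≤ L F) ∧
      (∀ F : Y →ₛ ℝ, (∀ y, 0 ≤ F y) → L F ≤ M F) ∧ S ∈ stabilizer L ∧ T ∈ stabilizer L ∧
      ∀ φ : Y →ₛ ℝ, pre T φ = φ → L φ = M (φ * θ) := by
  let x : ℕ → (Y →ₛ ℝ) →ₗ[ℝ] ℝ := fun n => M ∘ₗ LinearMap.mulRight ℝ (pre (T ^ n) θ)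
  have hx : ∀ n F, x n F = M (F * pre (T ^ n) θ) := fun n F => rfl
  have hxC : ∀ (F : Y →ₛ ℝ) (C : ℝ), (∀ y, |F y| ≤ C) → ∀ n, |x n F| ≤ C := by
    intro F C hC n
    rw [hx]
    refine hM.abs_map_le fun y => ?_
    rw [SimpleFunc.coe_mul, Pi.mul_apply, abs_mul, pre_apply, abs_of_nonneg (h0 _)]
    exact (mul_le_of_le_one_right (abs_nonneg _) (h1 _)).trans (hC y)
  have hxS : ∀ F n, x (n + 1) (pre S F) = x n F := by
    intro F n
    rw [hx, hx, ← hS (F * pre (T ^ n) θ), pre_mul, pre_pre,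
      ← (Commute.pow_right (show Commute S T from hcomm) n).eq, ← pre_pre (T ^ n) S, hθ, pre_pre,
      pow_succ']
  have hxT : ∀ F n, x (n + 1) (pre T F) = x n F := by
    intro F n
    rw [hx, hx, ← hT (F * pre (T ^ n) θ), pre_mul, pre_pre, pow_succ]
  let A : ℕ → (Y →ₛ ℝ) →ₗ[ℝ] ℝ := fun N => ((N : ℝ) + 1)⁻¹ • ∑ n ∈ Finset.range (N + 1), x n
  have hA : ∀ N F, A N F = ((N : ℝ) + 1)⁻¹ * ∑ n ∈ Finset.range (N + 1), x n F := by
    intro N F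
    simp [A]
  have hconst : ∀ (N : ℕ) (c : ℝ), ((N : ℝ) + 1)⁻¹ * ∑ n ∈ Finset.range (N + 1), c = c := by
    intro N c
    rw [Finset.sum_const, Finset.card_range, nsmul_eq_mul]
    push_cast
    field_simp
  have hAle : ∀ N F c, (∀ n, x n F ≤ c) → A N F ≤ c := by
    intro N F c h
    rw [hA, ← hconst N c]
    gcongr with n
    exact h n
  have hleA : ∀ N F c, (∀ n, c ≤ x n F) → c ≤ A N F := by
    intro N F c h
    rw [hA, ← hconst N c]
    gcongr with n
    exact h n
  obtain ⟨L, hL⟩ := exists_ultrafilter_limit (hyperfilter ℕ) A fun F => by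
    obtain ⟨C, -, hC⟩ := exists_abs_le F
    exact ⟨C, fun N => abs_le.2 ⟨hleA N F _ fun n => (abs_le.1 (hxC F C hC n)).1,
      hAle N F _ fun n => (abs_le.1 (hxC F C hC n)).2⟩⟩
  have hinv : ∀ g : MPerm Y, (∀ F n, x (n + 1) (pre g F) = x n F) → g ∈ stabilizer L := by
    intro g hg F
    obtain ⟨C, -, hC⟩ := exists_abs_le F
    have hlim : Tendsto (fun N => A N (pre g F) - A N F) (hyperfilter ℕ) (𝓝 0) := by
      refine squeeze_zero_norm (a := fun N : ℕ => 2 * C * ((N : ℝ) + 1)⁻¹) (fun N => ?_) ?_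
      · rw [hA, hA, ← mul_sub, norm_mul, Real.norm_eq_abs, Real.norm_eq_abs,
          abs_of_nonneg (by positivity), mul_comm]
        gcongr
        exact abs_sum_sub_sum_shift_le (hxC (pre g F) C fun y => hC _) (hg F) _
      · have := (tendsto_one_div_add_atTop_nhds_zero_nat (𝕜 := ℝ)).const_mul (2 * C)
        simp only [one_div, mul_zero] at this
        exact this.mono_left Nat.hyperfilter_le_atTop
    exact sub_eq_zero.1 (tendsto_nhds_unique ((hL (pre g F)).sub (hL F)) hlim)
  refine ⟨L, fun F hF => ?_, fun F hF => ?_, hinv S hxS, hinv T hxT, fun φ hφ => ?_⟩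
  · refine ge_of_tendsto' (hL F) fun N => hleA N F 0 fun n => hM.nonneg _ fun y => ?_
    exact mul_nonneg (hF y) (h0 _)
  · refine le_of_tendsto' (hL F) fun N => hAle N F _ fun n => hM.mono fun y => ?_
    exact mul_le_of_le_one_right (hF y) (h1 _)
  · have hxφ : ∀ n, x n φ = M (φ * θ) := by
      intro n
      have h1 : pre (T ^ n) φ = φ := pow_mem (mem_fixer.2 hφ) n
      rw [hx, ← pow_mem hT n (φ * θ), pre_mul, h1]
    refine tendsto_nhds_unique (hL φ) (Tendsto.congr (fun N => ?_) tendsto_const_nhds)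
    rw [hA]
    simp only [hxφ, hconst]

end Averages

/-- A system given by a state on simple functions invariant under two commuting permutations,
with an observable `f` and three labels invariant under `S`, `T` and `S * T⁻¹` respectively. -/
structure Sys where
  Y : Type u
  [meas : MeasurableSpace Y]
  S : MPerm Y
  T : MPerm Y
  comm : S * T = T * S
  Λ : (Y →ₛ ℝ) →ₗ[ℝ] ℝ
  state : IsState Λ
  hS : S ∈ stabilizer Λ
  hT : T ∈ stabilizer Λ
  f : Y →ₛ ℝ
  f0 : ∀ y, 0 ≤ f y
  f1 : ∀ y, f y ≤ 1
  a : Y →ₛ List ℝ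
  b : Y →ₛ List ℝ
  c : Y →ₛ List ℝ
  ha : pre S a = a
  hb : pre T b = b
  hc : pre S c = pre T c

attribute [instance] Sys.meas

namespace Sys

/-- The conditional expectation of the observable on the first two labels. -/
noncomputable def E₀ (Y : Sys.{u}) : Y.Y →ₛ ℝ := cexp Y.Λ Y.f (Y.a.pair Y.b)

/-- The conditional expectation of the observable on the first and third label. -/
noncomputable def E₁ (Y : Sys.{u}) : Y.Y →ₛ ℝ := cexp Y.Λ Y.f (Y.a.pair Y.c)

/-- The conditional expectation of the observable on the last two labels. -/
noncomputable def E₂ (Y : Sys.{u}) : Y.Y →ₛ ℝ := cexp Y.Λ Y.f (Y.b.pair Y.c)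

/-- The total squared distance of the observable to its conditional expectations. -/
noncomputable def D (Y : Sys.{u}) : ℝ :=
  dev Y.Λ Y.f (Y.a.pair Y.b) + dev Y.Λ Y.f (Y.a.pair Y.c) + dev Y.Λ Y.f (Y.b.pair Y.c)

lemma D_nonneg (Y : Sys.{u}) : 0 ≤ Y.D :=
  add_nonneg (add_nonneg (dev_nonneg Y.state _ _) (dev_nonneg Y.state _ _))
    (dev_nonneg Y.state _ _)

/-- Invariant functionals dominated by the state are multiples of it. -/
def Rigid (X : Sys.{u}) : Prop :=
  ∀ L : (X.Y →ₛ ℝ) →ₗ[ℝ] ℝ, (∀ F : X.Y →ₛ ℝ, (∀ x, 0 ≤ F x) → 0 ≤ L F) →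
    (∀ F : X.Y →ₛ ℝ, (∀ x, 0 ≤ F x) → L F ≤ X.Λ F) → X.S ∈ stabilizer L → X.T ∈ stabilizer L →
    ∀ F, L F = L 1 * X.Λ F

/-- Functions invariant under `T` are independent of functions invariant under `S * T⁻¹`. -/
def Mixing (Y : Sys.{u}) : Prop :=
  ∀ φ θ : Y.Y →ₛ ℝ, pre Y.T φ = φ → pre Y.S θ = pre Y.T θ → (∀ y, 0 ≤ θ y) → (∀ y, θ y ≤ 1) →
    Y.Λ (φ * θ) = Y.Λ φ * Y.Λ θ

/-- A factor map from `Z` to `Y`, exhibiting the labels of `Y` as functions of those of `Z`. -/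
structure Factor (Y Z : Sys.{u}) where
  π : Z.Y → Y.Y
  hπ : Measurable π
  hS : ∀ z, π (Z.S.1 z) = Y.S.1 (π z)
  hT : ∀ z, π (Z.T.1 z) = Y.T.1 (π z)
  hΛ : ∀ F : Y.Y →ₛ ℝ, Z.Λ (F.comp π hπ) = Y.Λ F
  hf : ∀ z, Z.f z = Y.f (π z)
  ra : List ℝ → List ℝ
  rb : List ℝ → List ℝ
  rc : List ℝ → List ℝ
  ha : ∀ z, Y.a (π z) = ra (Z.a z)
  hb : ∀ z, Y.b (π z) = rb (Z.b z)
  hc : ∀ z, Y.c (π z) = rc (Z.c z)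

/-- Composition of factor maps. -/
def Factor.trans {X Y Z : Sys.{u}} (p : Factor X Y) (q : Factor Y Z) : Factor X Z where
  π := p.π ∘ q.π
  hπ := p.hπ.comp q.hπ
  hS z := by simp [q.hS, p.hS]
  hT z := by simp [q.hT, p.hT]
  hΛ F := by rw [← p.hΛ, ← q.hΛ]; rfl
  hf z := by rw [q.hf, p.hf]; rfl
  ra := p.ra ∘ q.ra
  rb := p.rb ∘ q.rb
  rc := p.rc ∘ q.rc
  ha z := by simp [p.ha, q.ha]
  hb z := by simp [p.hb, q.hb]
  hc z := by simp [p.hc, q.hc]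

/-- The identity factor map. -/
def Factor.refl (X : Sys.{u}) : Factor X X where
  π := id
  hπ := measurable_id
  hS _ := rfl
  hT _ := rfl
  hΛ _ := rfl
  hf _ := rfl
  ra := id
  rb := id
  rc := id
  ha _ := rfl
  hb _ := rfl
  hc _ := rfl

end Sys

namespace Sys

section Ergodization

open Filter Topology

variable {X Y : Sys.{u}}

/-- The invariant states on `Y` that extend the state of the factor `X`. -/
def extendingStates (p : Factor X Y) : Set ((Y.Y →ₛ ℝ) → ℝ) :=
  {L | ∃ M : (Y.Y →ₛ ℝ) →ₗ[ℝ] ℝ, (∀ F, M F = L F) ∧ IsState M ∧ Y.S ∈ stabilizer M ∧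
    Y.T ∈ stabilizer M ∧ ∀ F : X.Y →ₛ ℝ, M (F.comp p.π p.hπ) = X.Λ F}

lemma isClosed_extendingStates (p : Factor X Y) : IsClosed (extendingStates p) := by
  refine isClosed_of_closure_subset fun L hL => ?_
  have key : ∀ Q : ((Y.Y →ₛ ℝ) → ℝ) → Prop, IsClosed {L | Q L} →
      (∀ L ∈ extendingStates p, Q L) → Q L := fun Q hQ h =>
    hQ.closure_subset_iff.2 h hL
  have hadd : ∀ F G, L (F + G) = L F + L G := fun F G =>
    key (fun L => L (F + G) = L F + L G) (isClosed_eq (by fun_prop) (by fun_prop))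
      fun L ⟨M, hM, _⟩ => by rw [← hM, ← hM, ← hM, map_add]
  have hsmul : ∀ (c : ℝ) F, L (c • F) = c * L F := fun c F =>
    key (fun L => L (c • F) = c * L F) (isClosed_eq (by fun_prop) (by fun_prop))
      fun L ⟨M, hM, _⟩ => by rw [← hM, ← hM, map_smul, smul_eq_mul]
  refine ⟨{ toFun := L, map_add' := hadd, map_smul' := hsmul }, fun F => rfl, ⟨?_, ?_⟩, ?_, ?_, ?_⟩
  · intro F hF
    exact key (fun L => 0 ≤ L F) (isClosed_le (by fun_prop) (by fun_prop))
      fun L ⟨M, hM, h, _⟩ => by rw [← hM]; exact h.nonneg F hF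
  · exact key (fun L => L 1 = 1) (isClosed_eq (by fun_prop) (by fun_prop))
      fun L ⟨M, hM, h, _⟩ => by rw [← hM]; exact h.map_one
  · intro F
    exact key (fun L => L (pre Y.S F) = L F) (isClosed_eq (by fun_prop) (by fun_prop))
      fun L ⟨M, hM, _, h, _⟩ => by rw [← hM, ← hM]; exact h F
  · intro F
    exact key (fun L => L (pre Y.T F) = L F) (isClosed_eq (by fun_prop) (by fun_prop))
      fun L ⟨M, hM, _, _, h, _⟩ => by rw [← hM, ← hM]; exact h F
  · intro F
    exact key (fun L => L (F.comp p.π p.hπ) = X.Λ F) (isClosed_eq (by fun_prop) (by fun_prop))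
      fun L ⟨M, hM, _, _, _, h⟩ => by rw [← hM]; exact h F

lemma isCompact_extendingStates (p : Factor X Y) : IsCompact (extendingStates p) := by
  choose C _ hC using fun F : Y.Y →ₛ ℝ => exists_abs_le F
  refine IsCompact.of_isClosed_subset (isCompact_univ_pi fun F => isCompact_Icc (a := -C F)
    (b := C F)) (isClosed_extendingStates p) ?_
  rintro L ⟨M, hM, h, _⟩ F -
  rw [← hM]
  exact abs_le.1 (h.abs_map_le (hC F))

lemma normalize_mem_extendingStates (hX : X.Rigid) (p : Factor X Y)
    {M : (Y.Y →ₛ ℝ) →ₗ[ℝ] ℝ} (hM : ∀ F : X.Y →ₛ ℝ, M (F.comp p.π p.hπ) = X.Λ F)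
    {L : (Y.Y →ₛ ℝ) →ₗ[ℝ] ℝ}
    (h0 : ∀ F : Y.Y →ₛ ℝ, (∀ y, 0 ≤ F y) → 0 ≤ L F)
    (h1 : ∀ F : Y.Y →ₛ ℝ, (∀ y, 0 ≤ F y) → L F ≤ M F)
    (hS : Y.S ∈ stabilizer L) (hT : Y.T ∈ stabilizer L) (hpos : 0 < L 1) :
    (fun F => (L 1)⁻¹ * L F) ∈ extendingStates p := by
  refine ⟨(L 1)⁻¹ • L, fun F => rfl, ⟨fun F hF => ?_, ?_⟩, fun F => ?_, fun F => ?_, fun F => ?_⟩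
  · exact mul_nonneg (inv_nonneg.2 hpos.le) (h0 F hF)
  · exact inv_mul_cancel₀ hpos.ne'
  · rw [LinearMap.smul_apply, LinearMap.smul_apply, hS]
  · rw [LinearMap.smul_apply, LinearMap.smul_apply, hT]
  · let q : (X.Y →ₛ ℝ) →ₗ[ℝ] ℝ :=
      { toFun := fun F => L (F.comp p.π p.hπ)
        map_add' := fun F G => L.map_add (F.comp p.π p.hπ) (G.comp p.π p.hπ)
        map_smul' := fun c F => L.map_smul c (F.comp p.π p.hπ) }
    have hq := hX q (fun F hF => h0 _ fun y => hF _)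
      (fun F hF => by rw [← hM]; exact h1 _ fun y => hF _) (fun F => ?_) (fun F => ?_) F
    · change (L 1)⁻¹ * q F = _
      rw [hq]
      change (L 1)⁻¹ * (L 1 * _) = _
      rw [inv_mul_cancel_left₀ hpos.ne']
    · change L _ = L _
      rw [← hS (F.comp p.π p.hπ)]
      congr 1
      ext y
      simp [p.hS]
    · change L _ = L _
      rw [← hT (F.comp p.π p.hπ)]
      congr 1
      ext y
      simp [p.hT]

lemma eq_zero_of_map_one {Z : Type*} [MeasurableSpace Z] {L : (Z →ₛ ℝ) →ₗ[ℝ] ℝ}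
    (h0 : ∀ F : Z →ₛ ℝ, (∀ y, 0 ≤ F y) → 0 ≤ L F) (h1 : L 1 = 0) (F : Z →ₛ ℝ) : L F = 0 := by
  obtain ⟨C, -, hC⟩ := exists_abs_le F
  have h2 := h0 (C • 1 - F) fun y => by simpa using (abs_le.1 (hC y)).2
  have h3 := h0 (C • 1 + F) fun y => by
    have := (abs_le.1 (hC y)).1
    simp; linarith
  rw [map_sub, map_smul, h1, smul_zero] at h2
  rw [map_add, map_smul, h1, smul_zero] at h3
  linarith

/-- The system obtained by replacing the state. -/
def withState (Y : Sys.{u}) (M : (Y.Y →ₛ ℝ) →ₗ[ℝ] ℝ) (hM : IsState M) (hS : Y.S ∈ stabilizer M)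
    (hT : Y.T ∈ stabilizer M) : Sys.{u} :=
  { Y with Λ := M, state := hM, hS := hS, hT := hT }

/-- An extension of a rigid system can be made mixing without increasing the deviation. -/
lemma exists_mixing (hX : X.Rigid) (p : Factor X Y) :
    ∃ Z : Sys.{u}, Nonempty (Factor X Z) ∧ Z.D ≤ Y.D ∧ Z.Mixing := by
  let ψ : Y.Y →ₛ ℝ := -((Y.f - Y.E₀) * (Y.f - Y.E₀) + (Y.f - Y.E₁) * (Y.f - Y.E₁)
    + (Y.f - Y.E₂) * (Y.f - Y.E₂))
  have hY : (fun F => Y.Λ F) ∈ extendingStates p :=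
    ⟨Y.Λ, fun F => rfl, Y.state, Y.hS, Y.hT, p.hΛ⟩
  obtain ⟨L₀, hL₀, hmax⟩ := (isCompact_extendingStates p).exists_isMaxOn ⟨_, hY⟩
    (continuous_apply ψ).continuousOn
  have hmax' : ∀ L ∈ extendingStates p, L ψ ≤ L₀ ψ := hmax
  obtain ⟨L, hL⟩ := ((isCompact_extendingStates p).inter_right
    (isClosed_eq (continuous_apply ψ) continuous_const :
      IsClosed {L : (Y.Y →ₛ ℝ) → ℝ | L ψ = L₀ ψ})).extremePoints_nonempty ⟨L₀, hL₀, rfl⟩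
  rw [mem_extremePoints] at hL
  obtain ⟨⟨⟨M, hML, hM, hMS, hMT, hMp⟩, hLψ⟩, hext⟩ := hL
  have hLψ : L ψ = L₀ ψ := hLψ
  refine ⟨Y.withState M hM hMS hMT, ⟨{ p with hΛ := hMp }⟩, ?_, ?_⟩
  · have h1 := dev_le hM Y.f (Y.a.pair Y.b) (condVal Y.Λ Y.f (Y.a.pair Y.b))
    have h2 := dev_le hM Y.f (Y.a.pair Y.c) (condVal Y.Λ Y.f (Y.a.pair Y.c))
    have h3 := dev_le hM Y.f (Y.b.pair Y.c) (condVal Y.Λ Y.f (Y.b.pair Y.c))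
    have h4 : Y.D = -Y.Λ ψ := by
      rw [map_neg, map_add, map_add, neg_neg]; rfl
    have h5 : M ψ = -(M ((Y.f - Y.E₀) * (Y.f - Y.E₀)) + M ((Y.f - Y.E₁) * (Y.f - Y.E₁))
        + M ((Y.f - Y.E₂) * (Y.f - Y.E₂))) := by
      rw [map_neg, map_add, map_add]
    have h6 : Y.Λ ψ ≤ M ψ := by
      rw [hML, hLψ]; exact hmax' _ hY
    calc _ ≤ M ((Y.f - Y.E₀) * (Y.f - Y.E₀)) + M ((Y.f - Y.E₁) * (Y.f - Y.E₁))
        + M ((Y.f - Y.E₂) * (Y.f - Y.E₂)) := add_le_add (add_le_add h1 h2) h3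
      _ ≤ Y.D := by linarith
  · suffices h : ∀ φ θ : Y.Y →ₛ ℝ, pre Y.T φ = φ → pre Y.S θ = pre Y.T θ → (∀ y, 0 ≤ θ y) →
        (∀ y, θ y ≤ 1) → M (φ * θ) = M φ * M θ from h
    intro φ θ hφ hθ h0 h1
    obtain ⟨N, hN0, hN1, hNS, hNT, hN⟩ := exists_average Y.comm hM hMS hMT hθ h0 h1
    have hNone : N 1 = M θ := by rw [hN 1 rfl, one_mul]
    suffices h : N φ = M φ * N 1 by rw [← hN φ hφ, h, hNone]
    have hN0' : ∀ F : Y.Y →ₛ ℝ, (∀ y, 0 ≤ F y) → 0 ≤ (M - N) F := fun F hF =>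
      sub_nonneg.2 (hN1 F hF)
    have hle : N 1 ≤ 1 := by
      have := hN1 1 fun y => by simp
      rwa [hM.map_one] at this
    have hN'1 : (M - N) 1 = 1 - N 1 := by rw [LinearMap.sub_apply, hM.map_one]
    rcases (hN0 1 fun y => by simp).eq_or_lt with ht | ht
    · rw [eq_zero_of_map_one hN0 ht.symm, ← ht, mul_zero]
    rcases hle.eq_or_lt with ht1 | ht1
    · have := eq_zero_of_map_one hN0' (by rw [hN'1, ht1, sub_self]) φ
      rw [LinearMap.sub_apply] at this
      rw [ht1]; linarith
    have hpos' : 0 < (M - N) 1 := by rw [hN'1]; linarith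
    have k1 := normalize_mem_extendingStates hX p hMp hN0 hN1 hNS hNT ht
    have k2 := normalize_mem_extendingStates hX p hMp hN0'
      (fun F hF => by rw [LinearMap.sub_apply]; linarith [hN0 F hF])
      (fun F => by rw [LinearMap.sub_apply, LinearMap.sub_apply, hMS, hNS])
      (fun F => by rw [LinearMap.sub_apply, LinearMap.sub_apply, hMT, hNT]) hpos'
    have hcomb : ∀ F, N 1 * ((N 1)⁻¹ * N F) + (1 - N 1) * (((M - N) 1)⁻¹ * (M - N) F) = L F := by
      intro F
      rw [← hN'1, mul_inv_cancel_left₀ ht.ne', mul_inv_cancel_left₀ hpos'.ne', LinearMap.sub_apply,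
        hML]
      ring
    have m1 := hmax' _ k1
    have m2 := hmax' _ k2
    have m3 := hcomb ψ
    rw [hLψ] at m3
    have e1 : (N 1)⁻¹ * N ψ = L₀ ψ := by nlinarith
    have e2 : ((M - N) 1)⁻¹ * (M - N) ψ = L₀ ψ := by nlinarith
    have := hext _ ⟨k1, e1⟩ _ ⟨k2, e2⟩ ⟨N 1, 1 - N 1, ht, by linarith, by ring, by
      ext F; exact hcomb F⟩
    have h8 := congrFun this.1 φ
    rw [hML, ← h8]
    field_simp

end Ergodization

end Sys

section AlmostPeriodic

/-- The rows of `τ` form a totally bounded family for the uniform distance. -/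
def AlmostPeriodic (τ : ℤ → ℤ → ℝ) : Prop :=
  ∀ δ : ℝ, 0 < δ → ∃ (κ : Type) (_ : Finite κ) (col : ℤ → κ),
    ∀ n n', col n = col n' → ∀ m, |τ n m - τ n' m| ≤ δ

namespace AlmostPeriodic

lemma zero : AlmostPeriodic fun _ _ => 0 :=
  fun δ hδ => ⟨Unit, inferInstance, fun _ => (), fun _ _ _ _ => by simpa using hδ.le⟩

lemma add {τ σ : ℤ → ℤ → ℝ} (hτ : AlmostPeriodic τ) (hσ : AlmostPeriodic σ) :
    AlmostPeriodic fun n m => τ n m + σ n m := by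
  intro δ hδ
  obtain ⟨κ, hκ, col, h⟩ := hτ (δ / 2) (by positivity)
  obtain ⟨κ', hκ', col', h'⟩ := hσ (δ / 2) (by positivity)
  refine ⟨κ × κ', inferInstance, fun n => (col n, col' n), fun n n' hn m => ?_⟩
  rw [Prod.mk.injEq] at hn
  have h1 := h n n' hn.1 m
  have h2 := h' n n' hn.2 m
  calc |τ n m + σ n m - (τ n' m + σ n' m)| = |(τ n m - τ n' m) + (σ n m - σ n' m)| := by ring_nf
    _ ≤ _ := abs_add_le _ _
    _ ≤ δ := by linarith

lemma const_mul {τ : ℤ → ℤ → ℝ} (hτ : AlmostPeriodic τ) (c : ℝ) :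
    AlmostPeriodic fun n m => c * τ n m := by
  intro δ hδ
  obtain ⟨κ, hκ, col, h⟩ := hτ (δ / (|c| + 1)) (by positivity)
  refine ⟨κ, hκ, col, fun n n' hn m => ?_⟩
  rw [← mul_sub, abs_mul]
  calc |c| * |τ n m - τ n' m| ≤ (|c| + 1) * (δ / (|c| + 1)) := by
        gcongr
        · linarith
        · exact h n n' hn m
    _ = δ := by field_simp

lemma sum {ι : Type*} (s : Finset ι) {τ : ι → ℤ → ℤ → ℝ} (h : ∀ i, AlmostPeriodic (τ i)) :
    AlmostPeriodic fun n m => ∑ i ∈ s, τ i n m := by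
  classical
  induction s using Finset.induction_on with
  | empty => exact zero
  | insert a s ha ih =>
    simp only [Finset.sum_insert ha]
    exact (h a).add ih

lemma mul_of_bounded {x y : ℤ → ℝ} (hx : ∀ n, |x n| ≤ 1) (hy : ∀ n, |y n| ≤ 1) :
    AlmostPeriodic fun n m => x n * y m := by
  intro δ hδ
  refine ⟨Set.Icc ⌊-1 / δ⌋ ⌊1 / δ⌋, inferInstance, fun n => ⟨⌊x n / δ⌋, ?_, ?_⟩,
    fun n n' hn m => ?_⟩
  · have := (abs_le.1 (hx n)).1
    gcongr
  · have := (abs_le.1 (hx n)).2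
    gcongr
  · have h1 : ⌊x n / δ⌋ = ⌊x n' / δ⌋ := congrArg Subtype.val hn
    have h2 := (Int.abs_sub_lt_one_of_floor_eq_floor h1).le
    rw [← sub_div, abs_div, abs_of_pos hδ, div_le_one hδ] at h2
    rw [← sub_mul, abs_mul]
    exact (mul_le_of_le_one_right (abs_nonneg _) (hy m)).trans h2

lemma of_approx {τ : ℤ → ℤ → ℝ}
    (h : ∀ δ : ℝ, 0 < δ → ∃ σ, AlmostPeriodic σ ∧ ∀ n m, |τ n m - σ n m| ≤ δ) :
    AlmostPeriodic τ := by
  intro δ hδ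
  obtain ⟨σ, hσ, hτσ⟩ := h (δ / 3) (by positivity)
  obtain ⟨κ, hκ, col, hc⟩ := hσ (δ / 3) (by positivity)
  refine ⟨κ, hκ, col, fun n n' hn m => ?_⟩
  have h1 := abs_le.1 (hτσ n m)
  have h2 := abs_le.1 (hτσ n' m)
  have h3 := abs_le.1 (hc n n' hn m)
  exact abs_le.2 ⟨by linarith, by linarith⟩

end AlmostPeriodic

end AlmostPeriodic

section Correlations

variable {Y : Type*} [MeasurableSpace Y]

lemma pre_comm {β : Type*} {g h : MPerm Y} (hgh : g * h = h * g) (F : Y →ₛ β) :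
    pre g (pre h F) = pre h (pre g F) := by
  rw [pre_pre, pre_pre, hgh]

lemma pre_sum {ι : Type*} (g : MPerm Y) (s : Finset ι) (F : ι → Y →ₛ ℝ) :
    pre g (∑ i ∈ s, F i) = ∑ i ∈ s, pre g (F i) := by
  ext y
  simp only [pre_apply, sum_simpleFunc_apply]

lemma pre_smul (g : MPerm Y) (c : ℝ) (F : Y →ₛ ℝ) : pre g (c • F) = c • pre g F := rfl

lemma pre_map {β γ : Type*} (g : MPerm Y) (F : Y →ₛ β) (H : β → γ) :
    pre g (F.map H) = (pre g F).map H := rfl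

lemma pre_zpow_eq {β : Type*} {S T : MPerm Y} (hcomm : S * T = T * S) {κ : Y →ₛ β}
    (hκ : pre S κ = pre T κ) (n : ℤ) : pre (T ^ n) κ = pre (S ^ n) κ := by
  have h1 : S * T⁻¹ ∈ fixer κ := by
    rw [mem_fixer, ← pre_pre, hκ, pre_pre, mul_inv_cancel, pre_one]
  have hc : Commute (S * T⁻¹) T :=
    Commute.mul_left (show Commute S T from hcomm) (Commute.inv_left (Commute.refl T))
  have h2 : S ^ n = (S * T⁻¹) ^ n * T ^ n := by rw [← hc.mul_zpow, inv_mul_cancel_right]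
  rw [h2, ← pre_pre, mem_fixer.1 (zpow_mem h1 n)]

/-- Correlations of functions invariant under `S`, `T` and `S * T⁻¹` respectively are almost
periodic as functions of the difference, given mixing. -/
lemma almostPeriodic_correlation {S T : MPerm Y} (hcomm : S * T = T * S)
    {Λ : (Y →ₛ ℝ) →ₗ[ℝ] ℝ} (hΛ : IsState Λ) (hS : S ∈ stabilizer Λ)
    (hmix : ∀ φ θ : Y →ₛ ℝ, pre T φ = φ → pre S θ = pre T θ → (∀ y, 0 ≤ θ y) → (∀ y, θ y ≤ 1) →
      Λ (φ * θ) = Λ φ * Λ θ)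
    {χ ψ κ : Y →ₛ ℝ} (hχ : pre S χ = χ) (hψ : pre T ψ = ψ) (hκ : pre S κ = pre T κ)
    (ψ1 : ∀ y, |ψ y| ≤ 1) (κ0 : ∀ y, 0 ≤ κ y) (κ1 : ∀ y, κ y ≤ 1) :
    AlmostPeriodic fun n m => Λ (χ * ψ * pre (S ^ (n - m)) κ) := by
  have hcz : ∀ n : ℤ, S * S ^ n = S ^ n * S := fun n => (Commute.self_zpow S n).eq
  have hTz : ∀ n : ℤ, T * S ^ n = S ^ n * T := fun n =>
    (Commute.zpow_right (show Commute T S from hcomm.symm) n).eq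
  have hψz : ∀ n : ℤ, pre T (pre (S ^ n) ψ) = pre (S ^ n) ψ := fun n => by
    rw [pre_comm (hTz n), hψ]
  have hκz : ∀ n : ℤ, pre S (pre (S ^ n) κ) = pre T (pre (S ^ n) κ) := fun n => by
    rw [pre_comm (hTz n), pre_comm (hcz n), hκ]
  have hκabs : ∀ y, |κ y| ≤ 1 := fun y => by rw [abs_of_nonneg (κ0 y)]; exact κ1 y
  have htrans : ∀ n m : ℤ, Λ (χ * ψ * pre (S ^ (n - m)) κ)
      = Λ (χ * (pre (S ^ m) ψ * pre (S ^ n) κ)) := by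
    intro n m
    rw [← zpow_mem hS m, pre_mul, pre_mul, mem_fixer.1 (zpow_mem (mem_fixer.2 hχ) m), pre_pre,
      ← zpow_add, sub_add_cancel, mul_assoc]
  let W : Submodule ℝ (Y →ₛ ℝ) := Submodule.span ℝ
    (Set.range fun p : ℤ × ℤ => pre (S ^ p.1) ψ * pre (S ^ p.2) κ)
  have hW : ∀ m n : ℤ, pre (S ^ m) ψ * pre (S ^ n) κ ∈ W := fun m n =>
    Submodule.subset_span ⟨(m, n), rfl⟩
  have hAP : ∀ Θ ∈ W, AlmostPeriodic fun n m => Λ (Θ * (pre (S ^ m) ψ * pre (S ^ n) κ)) := by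
    intro Θ hΘ
    induction hΘ using Submodule.span_induction with
    | mem Θ h =>
      obtain ⟨⟨i, j⟩, rfl⟩ := h
      have h1 : ∀ n m : ℤ, Λ ((pre (S ^ i) ψ * pre (S ^ j) κ) * (pre (S ^ m) ψ * pre (S ^ n) κ))
          = Λ (pre (S ^ j) κ * pre (S ^ n) κ) * Λ (pre (S ^ i) ψ * pre (S ^ m) ψ) := by
        intro n m
        rw [mul_mul_mul_comm, mul_comm (Λ _)]
        refine hmix _ _ ?_ ?_ ?_ ?_
        · rw [pre_mul, hψz, hψz]
        · rw [pre_mul, pre_mul, hκz, hκz]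
        · exact fun y => mul_nonneg (κ0 _) (κ0 _)
        · exact fun y => mul_le_one₀ (κ1 _) (κ0 _) (κ1 _)
      simp only [h1]
      refine AlmostPeriodic.mul_of_bounded (fun n => hΛ.abs_map_le fun y => ?_)
        (fun n => hΛ.abs_map_le fun y => ?_)
      · rw [SimpleFunc.coe_mul, Pi.mul_apply, abs_mul]
        exact mul_le_one₀ (hκabs _) (abs_nonneg _) (hκabs _)
      · rw [SimpleFunc.coe_mul, Pi.mul_apply, abs_mul]
        exact mul_le_one₀ (ψ1 _) (abs_nonneg _) (ψ1 _)
    | zero => simpa using AlmostPeriodic.zero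
    | add F G _ _ hF hG => simpa only [add_mul, map_add] using hF.add hG
    | smul c F _ hF => simpa only [smul_mul_assoc, map_smul, smul_eq_mul] using hF.const_mul c
  refine AlmostPeriodic.of_approx fun δ hδ => ?_
  let q : (Y →ₛ ℝ) → ℝ := fun Θ => Λ ((χ - Θ) * (χ - Θ))
  have hq : BddBelow (q '' W) := ⟨0, by
    rintro _ ⟨Θ, -, rfl⟩
    exact hΛ.nonneg _ fun y => mul_self_nonneg _⟩
  obtain ⟨_, ⟨Θ, hΘ, rfl⟩, hmin⟩ := exists_lt_of_csInf_lt
    (Set.Nonempty.image q ⟨0, W.zero_mem⟩) (lt_add_of_pos_right (sInf (q '' W)) (pow_pos hδ 2))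
  have hmin' : ∀ G ∈ W, q Θ ≤ q G + δ ^ 2 := fun G hG => by
    have := csInf_le hq ⟨G, hG, rfl⟩
    linarith
  refine ⟨_, hAP Θ hΘ, fun n m => ?_⟩
  rw [htrans, ← map_sub, ← sub_mul]
  set h := pre (S ^ m) ψ * pre (S ^ n) κ with hh
  have hmem : h ∈ W := hW m n
  have hone : Λ (h * h) ≤ 1 := by
    refine hΛ.le_of_le fun y => ?_
    have h1 : |h y| ≤ 1 := by
      rw [hh, SimpleFunc.coe_mul, Pi.mul_apply, abs_mul]
      exact mul_le_one₀ (ψ1 _) (abs_nonneg _) (hκabs _)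
    have := abs_le.1 h1
    rw [SimpleFunc.coe_mul, Pi.mul_apply]
    nlinarith
  have hexp : ∀ t : ℝ, q (Θ + t • h) = q Θ - 2 * t * Λ ((χ - Θ) * h) + t ^ 2 * Λ (h * h) := by
    intro t
    have : (χ - (Θ + t • h)) * (χ - (Θ + t • h))
        = (χ - Θ) * (χ - Θ) - (2 * t) • ((χ - Θ) * h) + t ^ 2 • (h * h) := by
      ext y; simp; ring
    simp only [q, this, map_add, map_sub, map_smul, smul_eq_mul]
  have hpos := hmin' _ (W.add_mem hΘ (W.smul_mem δ hmem))
  have hneg := hmin' _ (W.add_mem hΘ (W.smul_mem (-δ) hmem))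
  rw [hexp] at hpos hneg
  have hsq : δ ^ 2 * Λ (h * h) ≤ δ ^ 2 := mul_le_of_le_one_right (sq_nonneg δ) hone
  refine abs_le.2 ⟨?_, ?_⟩
  · refine le_of_mul_le_mul_left (?_ : δ * _ ≤ δ * _) hδ
    nlinarith
  · refine le_of_mul_le_mul_left (?_ : δ * _ ≤ δ * _) hδ
    nlinarith

lemma level_pair {β γ : Type*} [DecidableEq β] [DecidableEq γ] (ℓ : Y →ₛ β) (ℓ' : Y →ₛ γ)
    (k : β × γ) : level (ℓ.pair ℓ') k = level ℓ k.1 * level ℓ' k.2 := by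
  ext y
  by_cases h1 : ℓ y = k.1 <;> by_cases h2 : ℓ' y = k.2 <;> simp [h1, h2, Prod.ext_iff]

lemma level_mem_Icc {β : Type*} [DecidableEq β] (ℓ : Y →ₛ β) (k : β) (y : Y) :
    0 ≤ level ℓ k y ∧ level ℓ k y ≤ 1 := by
  rw [level_apply]; split_ifs <;> norm_num

end Correlations

namespace Sys

/-- The correlation of the conditional expectations along the two transformations. -/
noncomputable def tripleCorrelation (Y : Sys.{u}) (n : ℤ) : ℝ :=
  Y.Λ (Y.E₀ * pre (Y.S ^ n) Y.E₁ * pre (Y.T ^ n) Y.E₂)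

lemma almostPeriodic_tripleCorrelation {Y : Sys.{u}} (hY : Y.Mixing) :
    AlmostPeriodic fun n m => Y.tripleCorrelation (n - m) := by
  have expand : ∀ n m : ℤ, Y.tripleCorrelation (n - m)
      = ∑ i ∈ (Y.a.pair Y.b).range, ∑ j ∈ (Y.a.pair Y.c).range, ∑ k ∈ (Y.b.pair Y.c).range,
        condVal Y.Λ Y.f (Y.a.pair Y.b) i * condVal Y.Λ Y.f (Y.a.pair Y.c) j
          * condVal Y.Λ Y.f (Y.b.pair Y.c) k
          * Y.Λ ((level Y.a i.1 * level Y.a j.1) * (level Y.b i.2 * level Y.b k.1)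
            * pre (Y.S ^ (n - m)) (level Y.c j.2 * level Y.c k.2)) := by
    intro n m
    have ha : ∀ i, pre (Y.S ^ (n - m)) (level Y.a i) = level Y.a i := fun i => by
      rw [level, pre_map, mem_fixer.1 (zpow_mem (mem_fixer.2 Y.ha) (n - m))]
    have hb : ∀ i, pre (Y.T ^ (n - m)) (level Y.b i) = level Y.b i := fun i => by
      rw [level, pre_map, mem_fixer.1 (zpow_mem (mem_fixer.2 Y.hb) (n - m))]
    have hc : ∀ i, pre (Y.T ^ (n - m)) (level Y.c i) = pre (Y.S ^ (n - m)) (level Y.c i) :=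
      fun i => by rw [level, pre_map, pre_map, pre_zpow_eq Y.comm Y.hc]
    rw [tripleCorrelation, E₀, E₁, E₂, cexp, cexp, cexp, map_eq_sum_level, map_eq_sum_level,
      map_eq_sum_level, pre_sum, pre_sum, Finset.sum_mul_sum, Finset.sum_mul, map_sum]
    refine Finset.sum_congr rfl fun i _ => ?_
    rw [Finset.sum_mul_sum, map_sum]
    refine Finset.sum_congr rfl fun j _ => ?_
    rw [map_sum]
    refine Finset.sum_congr rfl fun k _ => ?_
    rw [pre_smul, pre_smul, smul_mul_smul_comm, smul_mul_smul_comm, map_smul, smul_eq_mul,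
      level_pair, level_pair, level_pair, pre_mul, pre_mul, ha, hb, hc, pre_mul]
    congr 2
    ring
  simp only [expand]
  refine AlmostPeriodic.sum _ fun i => AlmostPeriodic.sum _ fun j => AlmostPeriodic.sum _ fun k =>
    AlmostPeriodic.const_mul (almostPeriodic_correlation Y.comm Y.state Y.hS hY ?_ ?_ ?_ ?_ ?_ ?_) _
  · rw [pre_mul, level, level, pre_map, pre_map, Y.ha]
  · rw [pre_mul, level, level, pre_map, pre_map, Y.hb]
  · rw [pre_mul, pre_mul, level, level, pre_map, pre_map, pre_map, pre_map, Y.hc]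
  · intro y
    rw [SimpleFunc.coe_mul, Pi.mul_apply, abs_mul, abs_of_nonneg (level_mem_Icc _ _ _).1,
      abs_of_nonneg (level_mem_Icc _ _ _).1]
    exact mul_le_one₀ (level_mem_Icc _ _ _).2 (level_mem_Icc _ _ _).1 (level_mem_Icc _ _ _).2
  · exact fun y => mul_nonneg (level_mem_Icc _ _ _).1 (level_mem_Icc _ _ _).1
  · exact fun y =>
      mul_le_one₀ (level_mem_Icc _ _ _).2 (level_mem_Icc _ _ _).1 (level_mem_Icc _ _ _).2

end Sys

section SkewProducts

open Filter Topology

variable {Y : Type u} [MeasurableSpace Y]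

/-- The skew product of a measurable permutation with two integer translations. -/
def liftPerm (g : MPerm Y) (s t : ℤ) : MPerm (Y × ℤ × ℤ × ℕ) :=
  ⟨{  toFun := fun z => (g.1 z.1, z.2.1 + s, z.2.2.1 + t, z.2.2.2)
      invFun := fun z => (g.1.symm z.1, z.2.1 - s, z.2.2.1 - t, z.2.2.2)
      left_inv := fun z => by simp
      right_inv := fun z => by simp },
    (g.2.1.comp measurable_fst).prodMk
      ((measurable_of_countable (fun x : ℤ × ℤ × ℕ => (x.1 + s, x.2.1 + t, x.2.2))).comp
        measurable_snd),
    (g.2.2.comp measurable_fst).prodMk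
      ((measurable_of_countable (fun x : ℤ × ℤ × ℕ => (x.1 - s, x.2.1 - t, x.2.2))).comp
        measurable_snd)⟩

lemma liftPerm_apply (g : MPerm Y) (s t : ℤ) (z : Y × ℤ × ℤ × ℕ) :
    (liftPerm g s t).1 z = (g.1 z.1, z.2.1 + s, z.2.2.1 + t, z.2.2.2) := rfl

lemma liftPerm_mul (g h : MPerm Y) (s t s' t' : ℤ) :
    liftPerm g s t * liftPerm h s' t' = liftPerm (g * h) (s' + s) (t' + t) := by
  ext z
  all_goals simp [liftPerm_apply, Equiv.Perm.mul_apply, add_assoc]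

lemma liftPerm_inv (g : MPerm Y) (s t : ℤ) : (liftPerm g s t)⁻¹ = liftPerm g⁻¹ (-s) (-t) := by
  rw [inv_eq_iff_mul_eq_one, liftPerm_mul]
  ext z
  all_goals simp [liftPerm_apply]

lemma liftPerm_mem {K : Subgroup (MPerm (Y × ℤ × ℤ × ℕ))} {H : Subgroup (MPerm Y)}
    (h0 : ∀ g ∈ H, liftPerm g 0 0 ∈ K) (h1 : liftPerm (1 : MPerm Y) 1 0 ∈ K)
    (h2 : liftPerm (1 : MPerm Y) 0 1 ∈ K) {g : MPerm Y} (hg : g ∈ H) (s t : ℤ) :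
    liftPerm g s t ∈ K := by
  have k1 : ∀ s : ℤ, liftPerm (1 : MPerm Y) s 0 ∈ K := by
    intro s
    induction s using Int.induction_on with
    | zero => exact h0 1 (one_mem H)
    | succ i ih => simpa [liftPerm_mul] using mul_mem h1 ih
    | pred i ih => simpa [liftPerm_mul, liftPerm_inv, sub_eq_add_neg] using mul_mem (inv_mem h1) ih
  have k2 : ∀ s : ℤ, liftPerm (1 : MPerm Y) 0 s ∈ K := by
    intro s
    induction s using Int.induction_on with
    | zero => exact h0 1 (one_mem H)
    | succ i ih => simpa [liftPerm_mul] using mul_mem h2 ih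
    | pred i ih => simpa [liftPerm_mul, liftPerm_inv, sub_eq_add_neg] using mul_mem (inv_mem h2) ih
  simpa [liftPerm_mul] using mul_mem (mul_mem (h0 g hg) (k1 s)) (k2 t)

/-- The restriction of a simple function to a fibre of the product. -/
def slice {β : Type*} (p q : ℤ) (N : ℕ) (F : Y × ℤ × ℤ × ℕ →ₛ β) : Y →ₛ β :=
  F.comp (fun y => (y, p, q, N)) (by fun_prop)

@[simp] lemma slice_apply {β : Type*} (p q : ℤ) (N : ℕ) (F : Y × ℤ × ℤ × ℕ →ₛ β) (y : Y) :
    slice p q N F y = F (y, p, q, N) := rfl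

/-- Averaging a state over squares in the two integer directions. -/
lemma exists_square_state {Λ : (Y →ₛ ℝ) →ₗ[ℝ] ℝ} (hΛ : IsState Λ) {P : ℕ → Prop}
    (hP : ∃ᶠ N in atTop, P N) :
    ∃ L : (Y × ℤ × ℤ × ℕ →ₛ ℝ) →ₗ[ℝ] ℝ, IsState L ∧
      (∀ g ∈ stabilizer Λ, ∀ s t, liftPerm g s t ∈ stabilizer L) ∧
      (∀ F : Y →ₛ ℝ, L (F.comp Prod.fst measurable_fst) = Λ F) ∧
      ∀ (F : Y × ℤ × ℤ × ℕ →ₛ ℝ) (c : ℝ),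
        (∀ N, P N → ∑ p ∈ Finset.range (N + 1), ∑ q ∈ Finset.range (N + 1),
          Λ (slice p q N F) ≤ c * ((N : ℝ) + 1) ^ 2) → L F ≤ c := by
  let x : ℕ → ℕ → ℕ → (Y × ℤ × ℤ × ℕ →ₛ ℝ) →ₗ[ℝ] ℝ := fun N p q =>
    { toFun := fun F => Λ (slice p q N F)
      map_add' := fun F G => Λ.map_add (slice p q N F) (slice p q N G)
      map_smul' := fun c F => Λ.map_smul c (slice p q N F) }
  have hx : ∀ N p q F, x N p q F = Λ (slice p q N F) := fun _ _ _ _ => rfl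
  let A : ℕ → (Y × ℤ × ℤ × ℕ →ₛ ℝ) →ₗ[ℝ] ℝ := fun N =>
    (((N : ℝ) + 1) ^ 2)⁻¹ • ∑ p ∈ Finset.range (N + 1), ∑ q ∈ Finset.range (N + 1), x N p q
  have hA : ∀ N F, A N F = (((N : ℝ) + 1) ^ 2)⁻¹ *
      ∑ p ∈ Finset.range (N + 1), ∑ q ∈ Finset.range (N + 1), Λ (slice p q N F) := by
    intro N F
    simp [A, hx]
  have hconst : ∀ (N : ℕ) (c : ℝ), (((N : ℝ) + 1) ^ 2)⁻¹ *
      ∑ p ∈ Finset.range (N + 1), ∑ q ∈ Finset.range (N + 1), c = c := by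
    intro N c
    rw [Finset.sum_const, Finset.sum_const, Finset.card_range, nsmul_eq_mul, nsmul_eq_mul]
    push_cast
    field_simp
  have hAle : ∀ N F c, (∀ y, F y ≤ c) → A N F ≤ c := by
    intro N F c h
    rw [hA, ← hconst N c]
    gcongr with p _ q _
    exact hΛ.le_of_le fun y => h _
  have hleA : ∀ N F c, (∀ y, c ≤ F y) → c ≤ A N F := by
    intro N F c h
    rw [hA, ← hconst N c]
    gcongr with p _ q _
    exact hΛ.le_of_ge fun y => h _
  have : NeBot (atTop ⊓ 𝓟 {N | P N}) := frequently_mem_iff_neBot.1 hP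
  let U := Ultrafilter.of (atTop ⊓ 𝓟 {N | P N})
  have hU : (U : Filter ℕ) ≤ atTop := (Ultrafilter.of_le _).trans inf_le_left
  have hUP : ∀ᶠ N in (U : Filter ℕ), P N :=
    (Ultrafilter.of_le (atTop ⊓ 𝓟 {N | P N})).trans inf_le_right (mem_principal_self _)
  obtain ⟨L, hL⟩ := exists_ultrafilter_limit U A fun F => by
    obtain ⟨C, -, hC⟩ := exists_abs_le F
    exact ⟨C, fun N => abs_le.2 ⟨hleA N F _ fun n => (abs_le.1 (hC n)).1,
      hAle N F _ fun n => (abs_le.1 (hC n)).2⟩⟩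
  have hlim0 : ∀ C : ℝ, Tendsto (fun N : ℕ => C * ((N : ℝ) + 1)⁻¹) U (𝓝 0) := by
    intro C
    have := (tendsto_one_div_add_atTop_nhds_zero_nat (𝕜 := ℝ)).const_mul C
    simp only [one_div, mul_zero] at this
    exact this.mono_left hU
  have hinv : ∀ (g : MPerm (Y × ℤ × ℤ × ℕ)), (∀ F : Y × ℤ × ℤ × ℕ →ₛ ℝ, ∀ C : ℝ, (∀ y, |F y| ≤ C) →
      ∀ N : ℕ, |∑ p ∈ Finset.range (N + 1), ∑ q ∈ Finset.range (N + 1), Λ (slice p q N (pre g F))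
        - ∑ p ∈ Finset.range (N + 1), ∑ q ∈ Finset.range (N + 1), Λ (slice p q N F)|
        ≤ 2 * C * ((N : ℝ) + 1)) → g ∈ stabilizer L := by
    intro g hg F
    obtain ⟨C, -, hC⟩ := exists_abs_le F
    refine sub_eq_zero.1 (tendsto_nhds_unique ((hL (pre g F)).sub (hL F)) ?_)
    refine squeeze_zero_norm (fun N => ?_) (hlim0 (2 * C))
    rw [hA, hA, ← mul_sub, norm_mul, Real.norm_eq_abs, Real.norm_eq_abs,
      abs_of_nonneg (by positivity)]
    calc _ ≤ (((N : ℝ) + 1) ^ 2)⁻¹ * (2 * C * ((N : ℝ) + 1)) := by gcongr; exact hg F C hC N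
      _ = _ := by field_simp
  have hbd : ∀ (F : Y × ℤ × ℤ × ℕ →ₛ ℝ) (C : ℝ), (∀ y, |F y| ≤ C) → ∀ (p q : ℤ) (N : ℕ),
      |Λ (slice p q N F)| ≤ C := fun F C hC p q N => hΛ.abs_map_le fun y => hC _
  refine ⟨L, ⟨fun F hF => ?_, ?_⟩, fun g hg s t => liftPerm_mem (fun g hg => ?_) ?_ ?_ hg s t,
    fun F => ?_, fun F c hF => ?_⟩
  · exact ge_of_tendsto' (hL F) fun N => hleA N F 0 hF
  · exact le_antisymm (le_of_tendsto' (hL 1) fun N => hAle N 1 1 fun y => le_rfl)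
      (ge_of_tendsto' (hL 1) fun N => hleA N 1 1 fun y => le_rfl)
  · refine hinv _ fun F C hC N => ?_
    have : ∀ p q : ℤ, Λ (slice p q N (pre (liftPerm g 0 0) F)) = Λ (slice p q N F) := by
      intro p q
      rw [← hg (slice p q N F)]
      congr 1
      ext y
      simp [liftPerm_apply]
    simp only [this, sub_self, abs_zero]
    have := (abs_nonneg _).trans (hbd F C hC 0 0 0)
    positivity
  · refine hinv _ fun F C hC N => ?_
    rw [Finset.sum_comm, Finset.sum_comm (f := fun p q : ℕ => Λ (slice p q N F)),
      ← Finset.sum_sub_distrib]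
    refine (Finset.abs_sum_le_sum_abs _ _).trans ((Finset.sum_le_card_nsmul _ _ (2 * C)
      fun q _ => ?_).trans_eq (by simp; ring))
    rw [abs_sub_comm]
    refine abs_sum_sub_sum_shift_le (fun p => hbd F C hC _ _ _) (fun p => ?_) _
    congr 1
  · refine hinv _ fun F C hC N => ?_
    rw [← Finset.sum_sub_distrib]
    refine (Finset.abs_sum_le_sum_abs _ _).trans ((Finset.sum_le_card_nsmul _ _ (2 * C)
      fun q _ => ?_).trans_eq (by simp; ring))
    rw [abs_sub_comm]
    refine abs_sum_sub_sum_shift_le (fun p => hbd F C hC _ _ _) (fun p => ?_) _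
    congr 1
  · refine tendsto_nhds_unique (hL _) (Tendsto.congr (fun N => ?_) tendsto_const_nhds)
    rw [hA, ← hconst N (Λ F)]
    rfl
  · refine le_of_tendsto (hL F) (hUP.mono fun N hN => ?_)
    rw [hA, inv_mul_le_iff₀ (by positivity), mul_comm]
    exact hF N hN

end SkewProducts

section Gluing

variable {Y : Type u} [MeasurableSpace Y]

/-- The function on the skew product with given fibres, all taken from a finite set of shifts of
a function, cut down to a set of fibres. -/
noncomputable def orbitFunction (A : MPerm Y) (h : Y →ₛ ℝ) (e : ℤ × ℤ × ℕ → ℤ)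
    (E : Set (ℤ × ℤ × ℕ)) [DecidablePred (· ∈ E)] : Y × ℤ × ℤ × ℕ →ₛ ℝ where
  toFun z := if z.2 ∈ E then h ((A ^ e z.2).1 z.1) else 0
  measurableSet_fiber' x := by
    have h1 : ∀ i : ℤ × ℤ × ℕ, MeasurableSet
        {y : Y | (if i ∈ E then h ((A ^ e i).1 y) else 0) = x} := by
      intro i
      by_cases hi : i ∈ E
      · simp only [hi, if_true]
        exact (pre (A ^ e i) h).measurableSet_fiber x
      · simp [hi]
    have h2 : (fun z : Y × ℤ × ℤ × ℕ => if z.2 ∈ E then h ((A ^ e z.2).1 z.1) else 0) ⁻¹' {x}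
        = ⋃ i : ℤ × ℤ × ℕ, {y : Y | (if i ∈ E then h ((A ^ e i).1 y) else 0) = x} ×ˢ {i} := by
      ext z
      simp
    rw [h2]
    exact MeasurableSet.iUnion fun i => (h1 i).prod (measurableSet_singleton i)
  finite_range' := by
    refine (h.finite_range.union (Set.finite_singleton 0)).subset ?_
    rintro _ ⟨z, rfl⟩
    by_cases hz : z.2 ∈ E <;> simp [hz]

lemma orbitFunction_apply (A : MPerm Y) (h : Y →ₛ ℝ) (e : ℤ × ℤ × ℕ → ℤ)
    (E : Set (ℤ × ℤ × ℕ)) [DecidablePred (· ∈ E)] (z : Y × ℤ × ℤ × ℕ) :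
    orbitFunction A h e E z = if z.2 ∈ E then h ((A ^ e z.2).1 z.1) else 0 := rfl

lemma abs_orbitFunction_le (A : MPerm Y) {h : Y →ₛ ℝ} (hh : ∀ y, |h y| ≤ 1) (e : ℤ × ℤ × ℕ → ℤ)
    (E : Set (ℤ × ℤ × ℕ)) [DecidablePred (· ∈ E)] (z : Y × ℤ × ℤ × ℕ) :
    |orbitFunction A h e E z| ≤ 1 := by
  rw [orbitFunction_apply]
  split_ifs
  · exact hh _
  · simp

lemma liftPerm_mem_fixer_orbitFunction (A : MPerm Y) (h : Y →ₛ ℝ) (e : ℤ × ℤ × ℕ → ℤ)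
    (E : Set (ℤ × ℤ × ℕ)) [DecidablePred (· ∈ E)] {s t : ℤ}
    (he : ∀ p q N, e (p + s, q + t, N) = e (p, q, N) - 1)
    (hE : ∀ p q N, (p + s, q + t, N) ∈ E ↔ (p, q, N) ∈ E) :
    liftPerm A s t ∈ fixer (orbitFunction A h e E) := by
  rw [mem_fixer]
  ext ⟨y, p, q, N⟩
  simp only [pre_apply, orbitFunction_apply, liftPerm_apply, hE, he]
  congr 2
  rw [← Equiv.Perm.mul_apply, ← Subgroup.coe_mul, ← zpow_add_one, sub_add_cancel]

/-- Prepending the value of a function to a label pulled back along a map. -/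
noncomputable def extendLabel {Z : Type*} [MeasurableSpace Z] {π : Z → Y} (hπ : Measurable π)
    (α : Z →ₛ ℝ) (ℓ : Y →ₛ List ℝ) : Z →ₛ List ℝ :=
  (α.pair (ℓ.comp π hπ)).map fun x => x.1 :: x.2

@[simp] lemma extendLabel_apply {Z : Type*} [MeasurableSpace Z] {π : Z → Y} (hπ : Measurable π)
    (α : Z →ₛ ℝ) (ℓ : Y →ₛ List ℝ) (z : Z) : extendLabel hπ α ℓ z = α z :: ℓ (π z) := rfl

variable {Z : Type u} [MeasurableSpace Z] {π : Z → Y} (hπ : Measurable π)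
  {L : (Z →ₛ ℝ) →ₗ[ℝ] ℝ} {Λ : (Y →ₛ ℝ) →ₗ[ℝ] ℝ}

lemma map_extendLabel (α β : Z →ₛ ℝ) (f : Y →ₛ ℝ) (ℓ₁ ℓ₂ : Y →ₛ List ℝ) :
    ((extendLabel hπ α ℓ₁).pair (extendLabel hπ β ℓ₂)).map
      (fun x => condVal Λ f (ℓ₁.pair ℓ₂) (x.1.tail, x.2.tail))
      = (cexp Λ f (ℓ₁.pair ℓ₂)).comp π hπ := by
  ext z
  simp [cexp]

lemma dev_extendLabel_le (hL : IsState L) (hLΛ : ∀ F : Y →ₛ ℝ, L (F.comp π hπ) = Λ F)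
    (α β : Z →ₛ ℝ) (f : Y →ₛ ℝ) (ℓ₁ ℓ₂ : Y →ₛ List ℝ) :
    dev L (f.comp π hπ) ((extendLabel hπ α ℓ₁).pair (extendLabel hπ β ℓ₂))
      ≤ dev Λ f (ℓ₁.pair ℓ₂) := by
  refine (dev_le hL _ _ fun x => condVal Λ f (ℓ₁.pair ℓ₂) (x.1.tail, x.2.tail)).trans_eq ?_
  rw [map_extendLabel, dev, ← hLΛ]
  rfl

lemma dev_extendLabel_le_sub_sq (hL : IsState L) (hLΛ : ∀ F : Y →ₛ ℝ, L (F.comp π hπ) = Λ F)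
    {α β : Z →ₛ ℝ} (hα : ∀ z, |α z| ≤ 1) (hβ : ∀ z, |β z| ≤ 1) (f : Y →ₛ ℝ)
    (ℓ₁ ℓ₂ : Y →ₛ List ℝ) {c : ℝ} (hc : 0 ≤ c)
    (hcor : L ((f - cexp Λ f (ℓ₁.pair ℓ₂)).comp π hπ * (α * β)) ≤ -c) :
    dev L (f.comp π hπ) ((extendLabel hπ α ℓ₁).pair (extendLabel hπ β ℓ₂))
      ≤ dev Λ f (ℓ₁.pair ℓ₂) - c ^ 2 := by
  refine (dev_le_sub_sq hL _ _ (fun x => condVal Λ f (ℓ₁.pair ℓ₂) (x.1.tail, x.2.tail))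
    (fun x => x.1.headI * x.2.headI) (fun z => ?_) hc ?_).trans_eq ?_
  · simpa [abs_mul] using mul_le_one₀ (hα z) (abs_nonneg _) (hβ z)
  · rw [map_extendLabel]
    exact hcor
  · rw [map_extendLabel, dev, ← hLΛ]
    rfl

end Gluing

namespace Sys

open Filter

/-- A skew product extension with enlarged labels. -/
lemma exists_extension {Y : Sys.{u}} {L : (Y.Y × ℤ × ℤ × ℕ →ₛ ℝ) →ₗ[ℝ] ℝ} (hL : IsState L)
    (hLs : ∀ g ∈ stabilizer Y.Λ, ∀ s t, liftPerm g s t ∈ stabilizer L)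
    (hLΛ : ∀ F : Y.Y →ₛ ℝ, L (F.comp Prod.fst measurable_fst) = Y.Λ F)
    {s t s' t' : ℤ} {α β γ : Y.Y × ℤ × ℤ × ℕ →ₛ ℝ} (hα : liftPerm Y.S s t ∈ fixer α)
    (hβ : liftPerm Y.T s' t' ∈ fixer β)
    (hγ : liftPerm (Y.S * Y.T⁻¹) (s - s') (t - t') ∈ fixer γ)
    (hα1 : ∀ z, |α z| ≤ 1) (hβ1 : ∀ z, |β z| ≤ 1) (hγ1 : ∀ z, |γ z| ≤ 1) {c : ℝ} (hc : 0 ≤ c)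
    (hcor : L ((Y.f - Y.E₀).comp Prod.fst measurable_fst * (α * β)) ≤ -c ∨
      L ((Y.f - Y.E₁).comp Prod.fst measurable_fst * (α * γ)) ≤ -c ∨
      L ((Y.f - Y.E₂).comp Prod.fst measurable_fst * (β * γ)) ≤ -c) :
    ∃ Z : Sys.{u}, Nonempty (Factor Y Z) ∧ Z.D ≤ Y.D - c ^ 2 := by
  let m : Measurable (Prod.fst : Y.Y × ℤ × ℤ × ℕ → Y.Y) := measurable_fst
  have hST : liftPerm Y.S s t = liftPerm (Y.S * Y.T⁻¹) (s - s') (t - t') * liftPerm Y.T s' t' := by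
    rw [liftPerm_mul, inv_mul_cancel_right, add_sub_cancel, add_sub_cancel]
  let Z : Sys.{u} :=
    { Y := Y.Y × ℤ × ℤ × ℕ
      S := liftPerm Y.S s t
      T := liftPerm Y.T s' t'
      comm := by rw [liftPerm_mul, liftPerm_mul, Y.comm, add_comm s, add_comm t]
      Λ := L
      state := hL
      hS := hLs _ Y.hS s t
      hT := hLs _ Y.hT s' t'
      f := Y.f.comp Prod.fst m
      f0 := fun y => Y.f0 _
      f1 := fun y => Y.f1 _
      a := extendLabel m α Y.a
      b := extendLabel m β Y.b
      c := extendLabel m γ Y.c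
      ha := by
        ext1 z
        have h1 := DFunLike.congr_fun (mem_fixer.1 hα) z
        have h2 := DFunLike.congr_fun Y.ha z.1
        simp only [pre_apply, extendLabel_apply] at h1 h2 ⊢
        rw [h1, ← h2, liftPerm_apply]
      hb := by
        ext1 z
        have h1 := DFunLike.congr_fun (mem_fixer.1 hβ) z
        have h2 := DFunLike.congr_fun Y.hb z.1
        simp only [pre_apply, extendLabel_apply] at h1 h2 ⊢
        rw [h1, ← h2, liftPerm_apply]
      hc := by
        ext1 z
        have h1 := DFunLike.congr_fun (mem_fixer.1 hγ) ((liftPerm Y.T s' t').1 z)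
        have h2 := DFunLike.congr_fun Y.hc z.1
        simp only [pre_apply, extendLabel_apply] at h1 h2 ⊢
        rw [← h1, ← Equiv.Perm.mul_apply, ← Subgroup.coe_mul, ← hST, liftPerm_apply,
          liftPerm_apply, h2] }
  refine ⟨Z, ⟨⟨Prod.fst, m, fun z => rfl, fun z => rfl, hLΛ, fun z => rfl, List.tail, List.tail,
    List.tail, fun z => rfl, fun z => rfl, fun z => rfl⟩⟩, ?_⟩
  have hZ : Z.D = dev L (Y.f.comp Prod.fst m) ((extendLabel m α Y.a).pair (extendLabel m β Y.b))
      + dev L (Y.f.comp Prod.fst m) ((extendLabel m α Y.a).pair (extendLabel m γ Y.c))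
      + dev L (Y.f.comp Prod.fst m) ((extendLabel m β Y.b).pair (extendLabel m γ Y.c)) := rfl
  rw [hZ, D]
  have h0 := dev_extendLabel_le m hL hLΛ α β Y.f Y.a Y.b
  have h1 := dev_extendLabel_le m hL hLΛ α γ Y.f Y.a Y.c
  have h2 := dev_extendLabel_le m hL hLΛ β γ Y.f Y.b Y.c
  rcases hcor with h | h | h
  · linarith [dev_extendLabel_le_sub_sq m hL hLΛ hα1 hβ1 Y.f Y.a Y.b hc h]
  · linarith [dev_extendLabel_le_sub_sq m hL hLΛ hα1 hγ1 Y.f Y.a Y.c hc h]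
  · linarith [dev_extendLabel_le_sub_sq m hL hLΛ hβ1 hγ1 Y.f Y.b Y.c hc h]

lemma E₀_nonneg (Y : Sys.{u}) (y : Y.Y) : 0 ≤ Y.E₀ y := condVal_nonneg Y.state Y.f0 _ _
lemma E₁_nonneg (Y : Sys.{u}) (y : Y.Y) : 0 ≤ Y.E₁ y := condVal_nonneg Y.state Y.f0 _ _
lemma E₂_nonneg (Y : Sys.{u}) (y : Y.Y) : 0 ≤ Y.E₂ y := condVal_nonneg Y.state Y.f0 _ _
lemma E₀_le_one (Y : Sys.{u}) (y : Y.Y) : Y.E₀ y ≤ 1 := condVal_le_one Y.state Y.f1 _ _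
lemma E₁_le_one (Y : Sys.{u}) (y : Y.Y) : Y.E₁ y ≤ 1 := condVal_le_one Y.state Y.f1 _ _
lemma E₂_le_one (Y : Sys.{u}) (y : Y.Y) : Y.E₂ y ≤ 1 := condVal_le_one Y.state Y.f1 _ _

/-- The error in the triple correlation from replacing the unshifted function. -/
noncomputable def err₀ (Y : Sys.{u}) (n : ℤ) : ℝ :=
  Y.Λ ((Y.f - Y.E₀) * pre (Y.S ^ n) Y.f * pre (Y.T ^ n) Y.f)

/-- The error in the triple correlation from replacing the function shifted by `S`. -/
noncomputable def err₁ (Y : Sys.{u}) (n : ℤ) : ℝ :=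
  Y.Λ (Y.E₀ * pre (Y.S ^ n) (Y.f - Y.E₁) * pre (Y.T ^ n) Y.f)

/-- The error in the triple correlation from replacing the function shifted by `T`. -/
noncomputable def err₂ (Y : Sys.{u}) (n : ℤ) : ℝ :=
  Y.Λ (Y.E₀ * pre (Y.S ^ n) Y.E₁ * pre (Y.T ^ n) (Y.f - Y.E₂))

/-- The average of a sequence over differences in a set is at most `-c`. -/
def NegAverage (x : ℤ → ℝ) (v : ℤ) (D : Set ℤ) (N : ℕ) (c : ℝ) : Prop :=
  open Classical in ∑ p ∈ Finset.range (N + 1), ∑ q ∈ Finset.range (N + 1),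
    (if (p : ℤ) ∈ D ∧ (q : ℤ) ∈ D then x (v + p - q) else 0) ≤ -c * ((N : ℝ) + 1) ^ 2

open Classical in
/-- A negative correlation along differences in many sets gives a state on the skew product with
a negative correlation. -/
lemma exists_square_state_le {Y : Type u} [MeasurableSpace Y] {Λ : (Y →ₛ ℝ) →ₗ[ℝ] ℝ}
    (hΛ : IsState Λ) {A B : MPerm Y} {g h k : Y →ₛ ℝ} {x : ℤ → ℝ}
    (hx : ∀ n, Λ (g * (pre (A ^ (-n)) h * pre (B ^ (-n)) k)) = x n) {v : ℕ → ℤ} {D : ℕ → Set ℤ}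
    {c : ℝ} (hneg : ∃ᶠ N in atTop, NegAverage x (v N) (D N) N c) :
    ∃ L : (Y × ℤ × ℤ × ℕ →ₛ ℝ) →ₗ[ℝ] ℝ, IsState L ∧
      (∀ g ∈ stabilizer Λ, ∀ s t, liftPerm g s t ∈ stabilizer L) ∧
      (∀ F : Y →ₛ ℝ, L (F.comp Prod.fst measurable_fst) = Λ F) ∧
      L (g.comp Prod.fst measurable_fst *
        (orbitFunction A h (fun i => i.2.1 - i.1 - v i.2.2) {i | i.2.1 ∈ D i.2.2} *
          orbitFunction B k (fun i => i.2.1 - i.1 - v i.2.2) {i | i.1 ∈ D i.2.2})) ≤ -c := by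
  obtain ⟨L, hL, hLs, hLΛ, hLc⟩ := exists_square_state hΛ hneg
  refine ⟨L, hL, hLs, hLΛ, hLc _ _ fun N hN => le_of_eq_of_le ?_ hN⟩
  refine Finset.sum_congr rfl fun p _ => Finset.sum_congr rfl fun q _ => ?_
  have he : ((q : ℤ) - p - v N) = -(v N + p - q) := by ring
  split_ifs with hpq
  · rw [← hx, ← he]
    congr 1
    ext y
    simp [orbitFunction_apply, hpq]
  · rw [← map_zero Λ]
    congr 1
    ext y
    rw [not_and_or] at hpq
    rcases hpq with hpq | hpq <;> simp [orbitFunction_apply, hpq]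

lemma mul_inv_zpow_neg_mul_zpow {G : Type*} [Group G] {a b : G} (h : Commute a b) (n : ℤ) :
    (a * b⁻¹) ^ (-n) * a ^ n = b ^ n := by
  rw [h.inv_right.mul_zpow, inv_zpow', neg_neg, (h.zpow_zpow _ _).eq, mul_assoc, ← zpow_add,
    neg_add_cancel, zpow_zero, mul_one]

lemma abs_le_one_of {Z : Type*} [MeasurableSpace Z] {h : Z →ₛ ℝ} (h0 : ∀ y, 0 ≤ h y)
    (h1 : ∀ y, h y ≤ 1) (y : Z) : |h y| ≤ 1 :=
  abs_le.2 ⟨by linarith [h0 y], h1 y⟩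

/-- Negative average errors allow an extension with smaller deviation. -/
lemma exists_extension_of_negAverage (Y : Sys.{u}) {v : ℕ → ℤ} {D : ℕ → Set ℤ} {c : ℝ}
    (hc : 0 ≤ c) (h : (∃ᶠ N in atTop, NegAverage Y.err₀ (v N) (D N) N c) ∨
      (∃ᶠ N in atTop, NegAverage Y.err₁ (v N) (D N) N c) ∨
      ∃ᶠ N in atTop, NegAverage Y.err₂ (v N) (D N) N c) :
    ∃ Z : Sys.{u}, Nonempty (Factor Y Z) ∧ Z.D ≤ Y.D - c ^ 2 := by
  classical
  have hcm : Commute Y.S Y.T := Y.comm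
  have hz : ∀ z : Y.Y × ℤ × ℤ × ℕ, |(0 : Y.Y × ℤ × ℤ × ℕ →ₛ ℝ) z| ≤ 1 := fun z => by simp
  have hz' : ∀ g, g ∈ fixer (0 : Y.Y × ℤ × ℤ × ℕ →ₛ ℝ) := fun g => rfl
  have hf := abs_le_one_of Y.f0 Y.f1
  have hE₀ := abs_le_one_of Y.E₀_nonneg Y.E₀_le_one
  have hE₁ := abs_le_one_of Y.E₁_nonneg Y.E₁_le_one
  rcases h with h | h | h
  · obtain ⟨L, hL, hLs, hLΛ, hLc⟩ := exists_square_state_le (g := Y.f - Y.E₀) (A := Y.S⁻¹)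
      (B := Y.T⁻¹) (h := Y.f) (k := Y.f) Y.state (fun n => by
        rw [inv_zpow', inv_zpow', neg_neg, ← mul_assoc]; rfl) h
    refine exists_extension (s := -1) (t := 0) (s' := 0) (t' := 1) hL hLs hLΛ ?_ ?_ (hz' _)
      (abs_orbitFunction_le _ hf _ _) (abs_orbitFunction_le _ hf _ _) hz hc (Or.inl hLc)
    · rw [← inv_mem_iff, liftPerm_inv]
      exact liftPerm_mem_fixer_orbitFunction _ _ _ _ (fun p q N => by simp; ring) (by simp)
    · rw [← inv_mem_iff, liftPerm_inv]
      exact liftPerm_mem_fixer_orbitFunction _ _ _ _ (fun p q N => by simp; ring) (by simp)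
  · obtain ⟨L, hL, hLs, hLΛ, hLc⟩ := exists_square_state_le (g := Y.f - Y.E₁) (A := Y.S)
      (B := Y.S * Y.T⁻¹) (h := Y.E₀) (k := Y.f) (x := Y.err₁) Y.state (fun n => by
        rw [err₁, ← zpow_mem Y.hS n, pre_mul, pre_mul, pre_pre, pre_pre,
          mul_inv_zpow_neg_mul_zpow hcm, zpow_neg, inv_mul_cancel, pre_one, mul_left_comm,
          mul_assoc]) h
    refine exists_extension (s := 1) (t := 0) (s' := 1) (t' := 1) hL hLs hLΛ ?_ (hz' _) ?_
      (abs_orbitFunction_le _ hE₀ _ _) hz (abs_orbitFunction_le _ hf _ _) hc (Or.inr (Or.inl hLc))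
    · exact liftPerm_mem_fixer_orbitFunction _ _ _ _ (fun p q N => by simp; ring) (by simp)
    · exact liftPerm_mem_fixer_orbitFunction _ _ _ _ (fun p q N => by simp; ring) (by simp)
  · obtain ⟨L, hL, hLs, hLΛ, hLc⟩ := exists_square_state_le (g := Y.f - Y.E₂) (A := Y.T)
      (B := Y.T * Y.S⁻¹) (h := Y.E₀) (k := Y.E₁) (x := Y.err₂) Y.state (fun n => by
        rw [err₂, ← zpow_mem Y.hT n, pre_mul, pre_mul, pre_pre, pre_pre,
          mul_inv_zpow_neg_mul_zpow hcm.symm, zpow_neg, inv_mul_cancel, pre_one, mul_comm]) h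
    refine exists_extension (s := 1) (t := 1) (s' := 1) (t' := 0) hL hLs hLΛ (hz' _) ?_ ?_
      hz (abs_orbitFunction_le _ hE₀ _ _) (abs_orbitFunction_le _ hE₁ _ _) hc
      (Or.inr (Or.inr hLc))
    · exact liftPerm_mem_fixer_orbitFunction _ _ _ _ (fun p q N => by simp; ring) (by simp)
    · rw [← inv_mem_iff, liftPerm_inv, mul_inv_rev, inv_inv]
      exact liftPerm_mem_fixer_orbitFunction _ _ _ _ (fun p q N => by simp; ring) (by simp)

end Sys

namespace Sys

open Filter

lemma Factor.sq_le {Y Z : Sys.{u}} (p : Factor Y Z) {η : ℝ} (h : Y.D - η ≤ Z.D) :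
    Z.Λ ((Y.E₀.comp p.π p.hπ - Z.E₀) * (Y.E₀.comp p.π p.hπ - Z.E₀)) ≤ η ∧
    Z.Λ ((Y.E₁.comp p.π p.hπ - Z.E₁) * (Y.E₁.comp p.π p.hπ - Z.E₁)) ≤ η ∧
    Z.Λ ((Y.E₂.comp p.π p.hπ - Z.E₂) * (Y.E₂.comp p.π p.hπ - Z.E₂)) ≤ η := by
  have key : ∀ (ℓ₁ ℓ₂ : Y.Y →ₛ List ℝ) (m₁ m₂ : Z.Y →ₛ List ℝ) (r₁ r₂ : List ℝ → List ℝ),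
      (∀ z, ℓ₁ (p.π z) = r₁ (m₁ z)) → (∀ z, ℓ₂ (p.π z) = r₂ (m₂ z)) →
      dev Y.Λ Y.f (ℓ₁.pair ℓ₂) = dev Z.Λ Z.f (m₁.pair m₂) +
        Z.Λ (((cexp Y.Λ Y.f (ℓ₁.pair ℓ₂)).comp p.π p.hπ - cexp Z.Λ Z.f (m₁.pair m₂)) *
          ((cexp Y.Λ Y.f (ℓ₁.pair ℓ₂)).comp p.π p.hπ - cexp Z.Λ Z.f (m₁.pair m₂))) := by
    intro ℓ₁ ℓ₂ m₁ m₂ r₁ r₂ h₁ h₂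
    have hm : (m₁.pair m₂).map (fun x => condVal Y.Λ Y.f (ℓ₁.pair ℓ₂) (r₁ x.1, r₂ x.2))
        = (cexp Y.Λ Y.f (ℓ₁.pair ℓ₂)).comp p.π p.hπ := by
      ext z
      simp [cexp, h₁, h₂]
    have hpy := dev_pythagoras Z.state Z.f (m₁.pair m₂)
      (fun x => condVal Y.Λ Y.f (ℓ₁.pair ℓ₂) (r₁ x.1, r₂ x.2))
    rw [hm] at hpy
    have hd : dev Y.Λ Y.f (ℓ₁.pair ℓ₂) = Z.Λ ((Z.f - (cexp Y.Λ Y.f (ℓ₁.pair ℓ₂)).comp p.π p.hπ) *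
        (Z.f - (cexp Y.Λ Y.f (ℓ₁.pair ℓ₂)).comp p.π p.hπ)) := by
      rw [dev, ← p.hΛ]
      congr 1
      ext z
      simp [p.hf]
    rw [hd, hpy]
    congr 2
    ext z
    simp
    ring
  have h0 := key Y.a Y.b Z.a Z.b p.ra p.rb p.ha p.hb
  have h1 := key Y.a Y.c Z.a Z.c p.ra p.rc p.ha p.hc
  have h2 := key Y.b Y.c Z.b Z.c p.rb p.rc p.hb p.hc
  have n0 := Z.state.nonneg ((Y.E₀.comp p.π p.hπ - Z.E₀) * (Y.E₀.comp p.π p.hπ - Z.E₀))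
    fun _ => mul_self_nonneg _
  have n1 := Z.state.nonneg ((Y.E₁.comp p.π p.hπ - Z.E₁) * (Y.E₁.comp p.π p.hπ - Z.E₁))
    fun _ => mul_self_nonneg _
  have n2 := Z.state.nonneg ((Y.E₂.comp p.π p.hπ - Z.E₂) * (Y.E₂.comp p.π p.hπ - Z.E₂))
    fun _ => mul_self_nonneg _
  rw [D, D, h0, h1, h2] at h
  simp only [E₀, E₁, E₂] at n0 n1 n2 ⊢
  exact ⟨by linarith, by linarith, by linarith⟩

lemma semiconj_zpow {Y Z : Type*} [MeasurableSpace Y] [MeasurableSpace Z] {π : Z → Y}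
    {g : MPerm Z} {h : MPerm Y} (hgh : ∀ z, π (g.1 z) = h.1 (π z)) (n : ℤ) :
    ∀ z, π ((g ^ n).1 z) = (h ^ n).1 (π z) := by
  have hinv : ∀ z, π (g⁻¹.1 z) = h⁻¹.1 (π z) := by
    intro z
    suffices hs : h.1 (π (g⁻¹.1 z)) = h.1 (h⁻¹.1 (π z)) from h.1.injective hs
    rw [← hgh, ← Equiv.Perm.mul_apply, ← Equiv.Perm.mul_apply, ← Subgroup.coe_mul,
      ← Subgroup.coe_mul, mul_inv_cancel, mul_inv_cancel]
    rfl
  induction n using Int.induction_on with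
  | zero => exact fun z => rfl
  | succ i ih =>
    intro z
    rw [zpow_add_one, zpow_add_one, Subgroup.coe_mul, Subgroup.coe_mul, Equiv.Perm.mul_apply,
      Equiv.Perm.mul_apply, ih, hgh]
  | pred i ih =>
    intro z
    rw [zpow_sub_one, zpow_sub_one, Subgroup.coe_mul, Subgroup.coe_mul, Equiv.Perm.mul_apply,
      Equiv.Perm.mul_apply, ih, hinv]

lemma Factor.pre_zpow_S {Y Z : Sys.{u}} (p : Factor Y Z) (n : ℤ) (F : Y.Y →ₛ ℝ) :
    (pre (Y.S ^ n) F).comp p.π p.hπ = pre (Z.S ^ n) (F.comp p.π p.hπ) := by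
  ext z
  exact congrArg F (semiconj_zpow p.hS n z).symm

lemma Factor.pre_zpow_T {Y Z : Sys.{u}} (p : Factor Y Z) (n : ℤ) (F : Y.Y →ₛ ℝ) :
    (pre (Y.T ^ n) F).comp p.π p.hπ = pre (Z.T ^ n) (F.comp p.π p.hπ) := by
  ext z
  exact congrArg F (semiconj_zpow p.hT n z).symm

lemma map_mul_mul_le {Y : Type*} [MeasurableSpace Y] {Λ : (Y →ₛ ℝ) →ₗ[ℝ] ℝ} (hΛ : IsState Λ)
    {θ : ℝ} (hθ : 0 < θ) {g h : MPerm Y} (hg : g ∈ stabilizer Λ) (hh : h ∈ stabilizer Λ)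
    {a₀ a₁ a₂ b₀ b₁ b₂ : Y →ₛ ℝ} (ha₀ : ∀ y, |a₀ y| ≤ 1) (ha₁ : ∀ y, |a₁ y| ≤ 1)
    (hb₁ : ∀ y, |b₁ y| ≤ 1) (hb₂ : ∀ y, |b₂ y| ≤ 1)
    (h₀ : Λ ((b₀ - a₀) * (b₀ - a₀)) ≤ θ ^ 2) (h₁ : Λ ((b₁ - a₁) * (b₁ - a₁)) ≤ θ ^ 2)
    (h₂ : Λ ((b₂ - a₂) * (b₂ - a₂)) ≤ θ ^ 2) :
    Λ (b₀ * pre g b₁ * pre h b₂) ≤ Λ (a₀ * pre g a₁ * pre h a₂) + 3 * θ := by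
  have e : b₀ * pre g b₁ * pre h b₂ = a₀ * pre g a₁ * pre h a₂
      + (b₀ - a₀) * (pre g b₁ * pre h b₂) + pre g (b₁ - a₁) * (a₀ * pre h b₂)
      + pre h (b₂ - a₂) * (a₀ * pre g a₁) := by
    ext y
    simp
    ring
  have bd : ∀ x y : ℝ, |x| ≤ 1 → |y| ≤ 1 → |x * y| ≤ 1 := fun x y hx hy => by
    rw [abs_mul]; exact mul_le_one₀ hx (abs_nonneg _) hy
  have i0 := hΛ.mul_le (G := pre g b₁ * pre h b₂) hθ h₀ fun y => bd _ _ (hb₁ _) (hb₂ _)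
  have i1 := hΛ.mul_le (F := pre g (b₁ - a₁)) (G := a₀ * pre h b₂) hθ
    (by rw [← pre_mul, hg]; exact h₁) fun y => bd _ _ (ha₀ _) (hb₂ _)
  have i2 := hΛ.mul_le (F := pre h (b₂ - a₂)) (G := a₀ * pre g a₁) hθ
    (by rw [← pre_mul, hh]; exact h₂) fun y => bd _ _ (ha₀ _) (ha₁ _)
  rw [e, map_add, map_add, map_add]
  linarith

lemma Factor.tripleCorrelation_le {Y Z : Sys.{u}} (p : Factor Y Z) {θ : ℝ} (hθ : 0 < θ)
    (h : Y.D - θ ^ 2 ≤ Z.D) (n : ℤ) :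
    Y.tripleCorrelation n ≤ Z.tripleCorrelation n + 3 * θ := by
  obtain ⟨h0, h1, h2⟩ := p.sq_le h
  have e : Y.tripleCorrelation n = Z.Λ (Y.E₀.comp p.π p.hπ *
      pre (Z.S ^ n) (Y.E₁.comp p.π p.hπ) * pre (Z.T ^ n) (Y.E₂.comp p.π p.hπ)) := by
    rw [tripleCorrelation, ← p.hΛ, ← p.pre_zpow_S, ← p.pre_zpow_T]
    rfl
  have hb₁ : ∀ y, |Y.E₁.comp p.π p.hπ y| ≤ 1 := fun y => by
    rw [SimpleFunc.coe_comp]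
    exact abs_le_one_of Y.E₁_nonneg Y.E₁_le_one (p.π y)
  have hb₂ : ∀ y, |Y.E₂.comp p.π p.hπ y| ≤ 1 := fun y => by
    rw [SimpleFunc.coe_comp]
    exact abs_le_one_of Y.E₂_nonneg Y.E₂_le_one (p.π y)
  have ha₀ := abs_le_one_of Z.E₀_nonneg Z.E₀_le_one
  have ha₁ := abs_le_one_of Z.E₁_nonneg Z.E₁_le_one
  have hg : Z.S ^ n ∈ stabilizer Z.Λ := zpow_mem Z.hS n
  have hh : Z.T ^ n ∈ stabilizer Z.Λ := zpow_mem Z.hT n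
  rw [e]
  exact map_mul_mul_le Z.state hθ hg hh ha₀ ha₁ hb₁ hb₂ h0 h1 h2

/-- The correlation of the observable with its two shifts. -/
noncomputable def correlation (Y : Sys.{u}) (n : ℤ) : ℝ :=
  Y.Λ (Y.f * pre (Y.S ^ n) Y.f * pre (Y.T ^ n) Y.f)

lemma Factor.map_f {Y Z : Sys.{u}} (p : Factor Y Z) : Z.Λ Z.f = Y.Λ Y.f := by
  rw [← p.hΛ]
  congr 1
  ext z
  exact p.hf z

lemma Factor.correlation_eq {Y Z : Sys.{u}} (p : Factor Y Z) (n : ℤ) :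
    Z.correlation n = Y.correlation n := by
  have hf : Z.f = Y.f.comp p.π p.hπ := by
    ext z
    exact p.hf z
  rw [correlation, correlation, ← p.hΛ, hf, ← p.pre_zpow_S, ← p.pre_zpow_T]
  rfl

lemma correlation_eq_add (Y : Sys.{u}) (n : ℤ) :
    Y.correlation n = Y.tripleCorrelation n + (Y.err₀ n + Y.err₁ n + Y.err₂ n) := by
  rw [correlation, tripleCorrelation, err₀, err₁, err₂, ← map_add, ← map_add, ← map_add]
  congr 1
  ext y
  simp
  ring

lemma pow_four_le_tripleCorrelation (Y : Sys.{u}) : Y.Λ Y.f ^ 4 ≤ Y.tripleCorrelation 0 := by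
  rw [tripleCorrelation, zpow_zero, zpow_zero, pre_one, pre_one]
  exact pow_four_le_map_cexp Y.state Y.f0 Y.f1 _ _ _

/-- An extension whose deviation is almost minimal among all extensions. -/
lemma exists_almost_minimal (X : Sys.{u}) {η : ℝ} (hη : 0 < η) :
    ∃ Y : Sys.{u}, Nonempty (Factor X Y) ∧
      ∀ Z : Sys.{u}, Nonempty (Factor X Z) → Y.D - η ≤ Z.D := by
  have hne : (D '' {Z : Sys.{u} | Nonempty (Factor X Z)}).Nonempty :=
    ⟨_, X, ⟨Factor.refl X⟩, rfl⟩
  have hbdd : BddBelow (D '' {Z : Sys.{u} | Nonempty (Factor X Z)}) :=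
    ⟨0, by rintro _ ⟨Z, -, rfl⟩; exact Z.D_nonneg⟩
  obtain ⟨_, ⟨Y, hY, rfl⟩, hlt⟩ := exists_lt_of_csInf_lt hne (lt_add_of_pos_right _ hη)
  refine ⟨Y, hY, fun Z hZ => ?_⟩
  have := csInf_le hbdd ⟨Z, hZ, rfl⟩
  linarith

lemma negAverage_or {x y z : ℤ → ℝ} {v : ℤ} {D : Set ℤ} {N : ℕ} {c β : ℝ} (hβ : 0 ≤ β)
    (hc : 0 ≤ c)
    (hcard : ∃ s : Finset ℕ, s ⊆ Finset.range (N + 1) ∧ (∀ p ∈ s, (p : ℤ) ∈ D) ∧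
      β * ((N : ℝ) + 1) ≤ s.card)
    (h : ∀ p q : ℕ, p < N + 1 → q < N + 1 → (p : ℤ) ∈ D → (q : ℤ) ∈ D →
      x (v + p - q) + y (v + p - q) + z (v + p - q) ≤ -(3 * c)) :
    NegAverage x v D N (c * β ^ 2) ∨ NegAverage y v D N (c * β ^ 2) ∨
      NegAverage z v D N (c * β ^ 2) := by
  classical
  by_contra! hcon
  simp only [NegAverage, not_le] at hcon
  obtain ⟨s, hs, hsD, hsc⟩ := hcard
  obtain ⟨h0, h1, h2⟩ := hcon
  have hsum : ∑ p ∈ Finset.range (N + 1), ∑ q ∈ Finset.range (N + 1),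
      (if (p : ℤ) ∈ D ∧ (q : ℤ) ∈ D then
        x (v + p - q) + y (v + p - q) + z (v + p - q) else 0)
      ≤ ∑ p ∈ s, ∑ q ∈ s, -(3 * c) := by
    calc _ ≤ ∑ p ∈ Finset.range (N + 1), ∑ q ∈ Finset.range (N + 1),
          (if p ∈ s ∧ q ∈ s then -(3 * c) else 0) := by
          refine Finset.sum_le_sum fun p hp => Finset.sum_le_sum fun q hq => ?_
          have := h p q (Finset.mem_range.1 hp) (Finset.mem_range.1 hq)
          by_cases h1 : (p : ℤ) ∈ D ∧ (q : ℤ) ∈ D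
          · rw [if_pos h1]
            refine (this h1.1 h1.2).trans ?_
            split_ifs <;> linarith
          · rw [if_neg h1, if_neg fun h2 => h1 ⟨hsD _ h2.1, hsD _ h2.2⟩]
      _ = ∑ p ∈ s, ∑ q ∈ s, -(3 * c) := by
          simp only [ite_and, Finset.sum_ite_irrel, Finset.sum_const_zero, ← Finset.sum_filter,
            Finset.filter_mem_eq_inter, Finset.inter_eq_right.2 hs]
  have hsplit : ∀ p q : ℕ, (if (p : ℤ) ∈ D ∧ (q : ℤ) ∈ D then
        x (v + p - q) + y (v + p - q) + z (v + p - q) else 0)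
      = (if (p : ℤ) ∈ D ∧ (q : ℤ) ∈ D then x (v + p - q) else 0)
        + (if (p : ℤ) ∈ D ∧ (q : ℤ) ∈ D then y (v + p - q) else 0)
        + (if (p : ℤ) ∈ D ∧ (q : ℤ) ∈ D then z (v + p - q) else 0) := by
    intro p q
    split_ifs <;> simp
  simp only [hsplit, Finset.sum_add_distrib] at hsum
  rw [Finset.sum_const, Finset.sum_const, nsmul_eq_mul, nsmul_eq_mul] at hsum
  have h3 : (β * ((N : ℝ) + 1)) ^ 2 ≤ (s.card : ℝ) ^ 2 := by gcongr
  have h4 := mul_le_mul_of_nonneg_left h3 hc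
  nlinarith

/-- A coloured interval contains a large monochromatic set. -/
lemma exists_large_fiber {κ : Type*} [Finite κ] (col : ℤ → κ) (N : ℕ) :
    ∃ k : κ, ∃ s : Finset ℕ, s ⊆ Finset.range (N + 1) ∧ (∀ p ∈ s, col p = k) ∧
      (Nat.card κ : ℝ)⁻¹ * ((N : ℝ) + 1) ≤ s.card := by
  classical
  have := Fintype.ofFinite κ
  have hne : Nonempty κ := ⟨col 0⟩
  have hpos : (0 : ℝ) < Nat.card κ := by exact_mod_cast Nat.card_pos
  obtain ⟨k, -, hk⟩ := Finset.exists_le_card_fiber_of_nsmul_le_card_of_maps_to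
    (s := Finset.range (N + 1)) (t := Finset.univ) (f := fun p : ℕ => col p)
    (b := (Nat.card κ : ℝ)⁻¹ * ((N : ℝ) + 1)) (fun _ _ => Finset.mem_univ _)
    Finset.univ_nonempty (by
      rw [Finset.card_univ, ← Nat.card_eq_fintype_card, nsmul_eq_mul,
        mul_inv_cancel_left₀ hpos.ne', Finset.card_range]
      push_cast
      rfl)
  exact ⟨k, _, Finset.filter_subset _ _, fun p hp => (Finset.mem_filter.1 hp).2, hk⟩

/-- A finite colouring has bounded representatives of all colours. -/
lemma exists_bounded_representative {κ : Type*} [Finite κ] (col : ℤ → κ) :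
    ∃ B : ℕ, ∀ n, ∃ e, col e = col n ∧ |e| ≤ B := by
  classical
  have := Fintype.ofFinite κ
  choose r hr using fun k : Set.range col => k.2
  refine ⟨∑ k, (r k).natAbs, fun n => ⟨r ⟨col n, n, rfl⟩, hr _, ?_⟩⟩
  rw [Int.abs_eq_natAbs, Nat.cast_le]
  exact Finset.single_le_sum (f := fun k => (r k).natAbs) (fun _ _ => Nat.zero_le _)
    (Finset.mem_univ _)

/-- Recurrence for rigid systems. -/
theorem exists_correlation_gt {X : Sys.{u}} (hX : X.Rigid) {ε : ℝ} (hε : 0 < ε) :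
    ∃ N : ℤ, 0 < N ∧ ∀ M : ℤ, ∃ n, X.Λ X.f ^ 4 - ε < X.correlation n ∧ M ≤ n ∧ n < M + N := by
  by_contra! hcon
  have hθ : 0 < ε / 12 := by positivity
  obtain ⟨Y₀, ⟨p₀⟩, hY₀⟩ := exists_almost_minimal X (pow_pos hθ 2)
  obtain ⟨Y, ⟨p⟩, hYD, hY⟩ := exists_mixing hX p₀
  obtain ⟨κ, _, col, hcol⟩ := almostPeriodic_tripleCorrelation hY (ε / 8) (by positivity)
  replace hcol : ∀ n n', col n = col n' →
      ∀ m, |Y.tripleCorrelation (n - m) - Y.tripleCorrelation (n' - m)| ≤ ε / 8 := hcol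
  obtain ⟨B, hB⟩ := exists_bounded_representative col
  have hne : Nonempty κ := ⟨col 0⟩
  have hpos : (0 : ℝ) < Nat.card κ := by exact_mod_cast Nat.card_pos
  have hc : 0 < ε / 6 * (Nat.card κ : ℝ)⁻¹ ^ 2 := by positivity
  set c := ε / 6 * (Nat.card κ : ℝ)⁻¹ ^ 2 with hcdef
  obtain ⟨Y', ⟨p'⟩, hY'⟩ := exists_almost_minimal Y (half_pos (pow_pos hc 2))
  choose M hM using fun N : ℕ => hcon (2 * N + 2 * B + 1) (by positivity)
  choose e he heB using fun N : ℕ => hB (M N + N + B)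
  choose k s hs hsk hcard using fun N : ℕ => exists_large_fiber col N
  have hor : ∀ N : ℕ, NegAverage Y'.err₀ (M N + N + B - e N) {q | col q = k N} N c ∨
      NegAverage Y'.err₁ (M N + N + B - e N) {q | col q = k N} N c ∨
      NegAverage Y'.err₂ (M N + N + B - e N) {q | col q = k N} N c := by
    intro N
    refine negAverage_or (by positivity) (by positivity) ⟨s N, hs N, hsk N, hcard N⟩ ?_
    intro a b ha hb hak hbk
    have hab : col a = col b := (show col a = k N from hak).trans (show col b = k N from hbk).symm
    have heN := abs_le.1 (heB N)
    have h1 := hM N (M N + N + B - e N + a - b)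
    have h2 : X.correlation (M N + N + B - e N + a - b) ≤ X.Λ X.f ^ 4 - ε := by
      by_contra! hlt
      have := h1 hlt (by omega)
      omega
    have h3 := Y'.correlation_eq_add (M N + N + B - e N + a - b)
    rw [(p.trans p').correlation_eq] at h3
    have h4 := p'.tripleCorrelation_le hθ (by
      have := hY₀ Y' ⟨p.trans p'⟩
      linarith) (M N + N + B - e N + a - b)
    have h5 := abs_le.1 (hcol (e N) (M N + N + B) (he N) (e N - a + b))
    have h6 := abs_le.1 (hcol a b hab b)
    rw [sub_self] at h6
    rw [show e N - (e N - a + b) = (a : ℤ) - b by ring,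
      show M N + N + B - (e N - a + b) = M N + N + B - e N + a - b by ring] at h5
    have h7 := Y.pow_four_le_tripleCorrelation
    rw [p.map_f] at h7
    linarith
  obtain ⟨Z, ⟨r⟩, hZ⟩ := Y'.exists_extension_of_negAverage hc.le (by
    rw [← frequently_or_distrib, ← frequently_or_distrib]
    exact Frequently.of_forall hor)
  have := hY' Z ⟨p'.trans r⟩
  have := pow_pos hc 2
  linarith

end Sys

section MeasureSystems

/-- The simple function obtained by rounding down to multiples of `1 / K`. -/
noncomputable def roundDown {X : Type*} [MeasurableSpace X] {f : X → ℝ} (hf : Measurable f)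
    (hf1 : ∀ x, f x ≤ 1) (K : ℕ) : X →ₛ ℝ where
  toFun x := (⌊(K : ℝ) * f x⌋₊ : ℝ) / K
  measurableSet_fiber' y := by
    have : Measurable fun x => (⌊(K : ℝ) * f x⌋₊ : ℝ) / K :=
      ((measurable_of_countable (fun n : ℕ => (n : ℝ))).comp
        (Nat.measurable_floor.comp (hf.const_mul _))).div_const _
    exact this (measurableSet_singleton y)
  finite_range' := by
    refine ((Set.finite_Iic K).image fun n : ℕ => (n : ℝ) / K).subset ?_
    rintro _ ⟨x, rfl⟩
    refine ⟨_, Nat.floor_le_of_le (a := (K : ℝ) * f x) ?_, rfl⟩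
    exact mul_le_of_le_one_right (Nat.cast_nonneg K) (hf1 x)

lemma roundDown_le {X : Type*} [MeasurableSpace X] {f : X → ℝ} (hf : Measurable f)
    (hf0 : ∀ x, 0 ≤ f x) (hf1 : ∀ x, f x ≤ 1) {K : ℕ} (hK : 0 < K) (x : X) :
    roundDown hf hf1 K x ≤ f x := by
  have hK' : (0 : ℝ) < K := by exact_mod_cast hK
  exact (div_le_iff₀ hK').2 ((Nat.floor_le (mul_nonneg hK'.le (hf0 x))).trans_eq (mul_comm _ _))

lemma roundDown_nonneg {X : Type*} [MeasurableSpace X] {f : X → ℝ} (hf : Measurable f)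
    (hf1 : ∀ x, f x ≤ 1) (K : ℕ) (x : X) : 0 ≤ roundDown hf hf1 K x :=
  div_nonneg (Nat.cast_nonneg _) (Nat.cast_nonneg _)

lemma le_roundDown_add {X : Type*} [MeasurableSpace X] {f : X → ℝ} (hf : Measurable f)
    (hf1 : ∀ x, f x ≤ 1) {K : ℕ} (hK : 0 < K) (x : X) :
    f x ≤ roundDown hf hf1 K x + 1 / K := by
  have hK' : (0 : ℝ) < K := by exact_mod_cast hK
  suffices h : f x ≤ (⌊(K : ℝ) * f x⌋₊ : ℝ) / K + 1 / K from h
  rw [← add_div, le_div_iff₀ hK', mul_comm]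
  exact (Nat.lt_floor_add_one _).le

/-- A measurable equivalence as a measurable permutation. -/
def toMPerm {X : Type*} [MeasurableSpace X] (T : X ≃ᵐ X) : MPerm X :=
  ⟨T.toEquiv, T.measurable, T.symm.measurable⟩

lemma toMPerm_mem_stabilizer {X : Type*} [MeasurableSpace X] {μ : Measure X} [IsFiniteMeasure μ]
    {T : X ≃ᵐ X} (hT : MeasurePreserving T μ μ) : toMPerm T ∈ stabilizer (integralFunctional μ) :=
  fun F => hT.integral_comp T.measurableEmbedding F

variable {X : Type u} [MeasurableSpace X]

/-- The system of a simple function on a probability space with commuting transformations. -/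
noncomputable def measureSys (μ : Measure X) [IsProbabilityMeasure μ] {T₁ T₂ : X ≃ᵐ X}
    (h₁ : MeasurePreserving T₁ μ μ) (h₂ : MeasurePreserving T₂ μ μ)
    (hcomm : ∀ x, T₁ (T₂ x) = T₂ (T₁ x)) (f : X →ₛ ℝ) (f0 : ∀ x, 0 ≤ f x) (f1 : ∀ x, f x ≤ 1) :
    Sys.{u} where
  Y := X
  S := toMPerm T₁
  T := toMPerm T₂
  comm := Subtype.ext (Equiv.ext hcomm)
  Λ := integralFunctional μ
  state := isState_integralFunctional μ
  hS := toMPerm_mem_stabilizer h₁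
  hT := toMPerm_mem_stabilizer h₂
  f := f
  f0 := f0
  f1 := f1
  a := SimpleFunc.const X []
  b := SimpleFunc.const X []
  c := SimpleFunc.const X []
  ha := rfl
  hb := rfl
  hc := rfl

lemma rigid_measureSys {μ : Measure X} [IsProbabilityMeasure μ] {T₁ T₂ : X ≃ᵐ X}
    (h₁ : MeasurePreserving T₁ μ μ) (h₂ : MeasurePreserving T₂ μ μ)
    (hcomm : ∀ x, T₁ (T₂ x) = T₂ (T₁ x))
    (herg : ∀ s : Set X, MeasurableSet s → T₁ ⁻¹' s = s → T₂ ⁻¹' s = s → μ s = 0 ∨ μ s = 1)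
    (f : X →ₛ ℝ) (f0 : ∀ x, 0 ≤ f x) (f1 : ∀ x, f x ≤ 1) :
    (measureSys μ h₁ h₂ hcomm f f0 f1).Rigid := fun _ hL0 hL1 hLS hLT F =>
  eq_mul_integralFunctional (μ := μ) (S := toMPerm T₁) (T := toMPerm T₂) (C := 1)
    (Subtype.ext (Equiv.ext hcomm)) (toMPerm_mem_stabilizer h₁) (toMPerm_mem_stabilizer h₂) herg
    hL0 (fun F hF => by rw [one_mul]; exact hL1 F hF) hLS hLT F

lemma pow_four_sub_le {a b d : ℝ} (hb : 0 ≤ b) (hab : b ≤ a) (ha : a ≤ 1) (hd : a ≤ b + d) :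
    a ^ 4 ≤ b ^ 4 + 4 * d := by
  have h1 : a ^ 4 - b ^ 4 = (a - b) * (a ^ 3 + a ^ 2 * b + a * b ^ 2 + b ^ 3) := by ring
  have ha0 := hb.trans hab
  have h2 : a ^ 3 + a ^ 2 * b + a * b ^ 2 + b ^ 3 ≤ 1 + 1 * 1 + 1 * 1 + 1 := by
    have hb1 := hab.trans ha
    gcongr <;> exact pow_le_one₀ ‹_› ‹_›
  nlinarith

end MeasureSystems

theorem multiple_recurrence_two_commuting_functional
    {X : Type*} [MeasurableSpace X] (μ : Measure X) [IsProbabilityMeasure μ]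
    (T₁ T₂ : X ≃ᵐ X)
    (h₁ : MeasurePreserving T₁ μ μ) (h₂ : MeasurePreserving T₂ μ μ)
    (hcomm : ∀ x, T₁ (T₂ x) = T₂ (T₁ x))
    (herg : ∀ s : Set X, MeasurableSet s → T₁ ⁻¹' s = s → T₂ ⁻¹' s = s →
      μ s = 0 ∨ μ s = 1)
    (f : X → ℝ) (hf : Measurable f) (hf0 : ∀ x, 0 ≤ f x) (hf1 : ∀ x, f x ≤ 1)
    (ε : ℝ) (hε : 0 < ε) :
    Syndetic {n : ℤ |
      ∫ x, f x * f ((T₁.toEquiv ^ n) x) * f ((T₂.toEquiv ^ n) x) ∂μ >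
        (∫ x, f x ∂μ) ^ 4 - ε} := by
  obtain ⟨K, hK0, hK⟩ : ∃ K : ℕ, 0 < K ∧ 4 * (1 / (K : ℝ)) ≤ ε / 2 := by
    obtain ⟨K, hK⟩ := exists_nat_gt (8 / ε)
    have hK' : (0 : ℝ) < K := lt_trans (by positivity) hK
    refine ⟨K, by exact_mod_cast hK', ?_⟩
    rw [div_lt_iff₀ hε] at hK
    rw [mul_one_div, div_le_iff₀ hK']
    linarith
  let g := roundDown hf hf1 K
  have gf : ∀ x, g x ≤ f x := roundDown_le hf hf0 hf1 hK0
  have g0 : ∀ x, 0 ≤ g x := roundDown_nonneg hf hf1 K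
  have hint : ∀ h : X → ℝ, Measurable h → (∀ x, 0 ≤ h x) → (∀ x, h x ≤ 1) → Integrable h μ :=
    fun h hm h0 h1 => Integrable.of_bound hm.aestronglyMeasurable 1
      (Filter.Eventually.of_forall fun x => by
        rw [Real.norm_eq_abs, abs_of_nonneg (h0 x)]; exact h1 x)
  have hfi := hint f hf hf0 hf1
  have hgi : Integrable g μ := g.integrable_of_isFiniteMeasure
  have h4 : (∫ x, f x ∂μ) ^ 4 ≤ (∫ x, g x ∂μ) ^ 4 + 4 * (1 / K) := by
    refine pow_four_sub_le (integral_nonneg g0) (integral_mono hgi hfi gf) ?_ ?_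
    · simpa using integral_mono hfi (integrable_const (1 : ℝ)) hf1
    · have := integral_mono hfi (hgi.add (integrable_const (1 / (K : ℝ))))
        (le_roundDown_add hf hf1 hK0)
      rw [integral_add' hgi (integrable_const _)] at this
      simpa using this
  obtain ⟨N, hN, h⟩ := Sys.exists_correlation_gt
    (rigid_measureSys h₁ h₂ hcomm herg g g0 fun x => (gf x).trans (hf1 x)) (half_pos hε)
  refine ⟨N, hN, fun M => ?_⟩
  obtain ⟨n, hn, hMn, hnN⟩ := h M
  refine ⟨n, ?_, hMn, hnN⟩
  have hn : (∫ x, g x ∂μ) ^ 4 - ε / 2 < ∫ x, g x * g (((toMPerm T₁) ^ n).1 x) *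
      g (((toMPerm T₂) ^ n).1 x) ∂μ := hn
  have m₁ : Measurable fun x => (T₁.toEquiv ^ n) x := (toMPerm T₁ ^ n).2.1
  have m₂ : Measurable fun x => (T₂.toEquiv ^ n) x := (toMPerm T₂ ^ n).2.1
  have hle : ∫ x, g x * g (((toMPerm T₁) ^ n).1 x) * g (((toMPerm T₂) ^ n).1 x) ∂μ ≤
      ∫ x, f x * f ((T₁.toEquiv ^ n) x) * f ((T₂.toEquiv ^ n) x) ∂μ := by
    refine integral_mono (g * pre (toMPerm T₁ ^ n) g *
      pre (toMPerm T₂ ^ n) g).integrable_of_isFiniteMeasure ?_ fun x => ?_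
    · refine hint _ ((hf.mul (hf.comp m₁)).mul (hf.comp m₂))
        (fun x => mul_nonneg (mul_nonneg (hf0 _) (hf0 _)) (hf0 _)) fun x => ?_
      exact mul_le_one₀ (mul_le_one₀ (hf1 _) (hf0 _) (hf1 _)) (hf0 _) (hf1 _)
    · exact mul_le_mul (mul_le_mul (gf _) (gf _) (g0 _) (hf0 _)) (gf _) (g0 _)
        (mul_nonneg (hf0 _) (hf0 _))
  suffices hs : (∫ x, f x ∂μ) ^ 4 - ε <
      ∫ x, f x * f ((T₁.toEquiv ^ n) x) * f ((T₂.toEquiv ^ n) x) ∂μ from hs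
  linarith
end

section
/- For every real number c with 0 < c ≤ 1, there exist a probability space (X, μ), two commuting invertible measure-preserving transformations T₁, T₂ such that the system (X, μ, T₁, T₂) is ergodic, and a measurable set A ⊆ X with μ(A) > 0, such that μ(A ∩ T₁ⁿA ∩ T₂ⁿA) < c·μ(A)³ for every integer n ≠ 0. -/
open MeasureTheory

open ProbabilityTheory in
/-- A measurable set of a Bernoulli space that is invariant under reindexings displacing any given
finite set of coordinates has measure zero or one. -/
theorem measure_infinitePi_eq_zero_or_one_of_invariant {ι E : Type*} [MeasurableSpace E]
    (P : Measure E) [IsProbabilityMeasure P] {s : Set (ι → E)} (hs : MeasurableSet s)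
    (h : ∀ I : Finset ι, ∃ τ : ι → ι, τ.Injective ∧ (∀ i ∈ I, τ i ∉ I) ∧
      (fun x i ↦ x (τ i)) ⁻¹' s = s) :
    Measure.infinitePi (fun _ : ι ↦ P) s = 0 ∨ Measure.infinitePi (fun _ : ι ↦ P) s = 1 := by
  classical
  set μ := Measure.infinitePi (fun _ : ι ↦ P)
  have key : ∀ ε > 0, |μ.real s - μ.real s ^ 2| ≤ 4 * ε := by
    intro ε hε
    obtain ⟨t, ht, hts⟩ := exists_measure_symmDiff_lt_of_generateFrom_isSetRing (μ := μ)
      (isSetRing_measurableCylinders (α := fun _ : ι ↦ E))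
      ⟨{Set.univ}, by simp, by simpa using univ_mem_measurableCylinders (fun _ : ι ↦ E), by simp⟩
      generateFrom_measurableCylinders.symm hs (ENNReal.ofReal_pos.2 hε)
    obtain ⟨I, S, hS, rfl⟩ := (mem_measurableCylinders _).1 ht
    obtain ⟨τ, hτ, hI, hinv⟩ := h I
    set f : (ι → E) → ι → E := fun x i ↦ x (τ i)
    have hfm : Measurable f := by fun_prop
    have hfp : MeasurePreserving f μ μ :=
      ⟨hfm, Measure.map_infinitePi_infinitePi_of_inj (P := fun _ : ι ↦ P) hτ⟩
    set t : Set (ι → E) := cylinder (α := fun _ ↦ E) I S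
    have htm : MeasurableSet t := MeasurableSet.cylinder I hS
    have hindep : μ.real (t ∩ f ⁻¹' t) = μ.real t * μ.real t := by
      have h1 : iIndepFun (fun i (x : ι → E) ↦ x i) μ :=
        iIndepFun_infinitePi (X := fun _ x ↦ x) (by fun_prop)
      have hd : Disjoint I (I.image τ) := by
        rw [Finset.disjoint_right]
        intro j hj
        obtain ⟨i, hi, rfl⟩ := Finset.mem_image.1 hj
        exact hI i hi
      have h2 := h1.indepFun_finset I (I.image τ) hd (by fun_prop)
      have h3 : IndepFun (I.restrict) (fun x : ι → E ↦ I.restrict (f x)) μ :=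
        h2.comp (φ := id)
          (ψ := fun (y : I.image τ → E) (i : I) ↦ y ⟨τ i.1, Finset.mem_image_of_mem τ i.2⟩)
          measurable_id (by fun_prop)
      have h4 := h3.measure_inter_preimage_eq_mul S S hS hS
      have h5 : μ (f ⁻¹' t) = μ t := hfp.measure_preimage htm.nullMeasurableSet
      change μ (t ∩ f ⁻¹' t) = μ t * μ (f ⁻¹' t) at h4
      rw [measureReal_def, measureReal_def, h4, h5, ENNReal.toReal_mul]
    have e1 : μ.real (symmDiff t s) ≤ ε := ENNReal.toReal_le_of_le_ofReal hε.le hts.le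
    have e2 : μ.real (symmDiff (f ⁻¹' t) s) ≤ ε := by
      have : symmDiff (f ⁻¹' t) s = f ⁻¹' (symmDiff t s) := by
        rw [Set.preimage_symmDiff, hinv]
      rw [this, measureReal_def, hfp.measure_preimage (htm.symmDiff hs).nullMeasurableSet]
      exact e1
    have e3 : μ.real (symmDiff (t ∩ f ⁻¹' t) s) ≤ 2 * ε := by
      have hsub : symmDiff (t ∩ f ⁻¹' t) s ⊆ symmDiff t s ∪ symmDiff (f ⁻¹' t) s := by
        intro x
        simp only [Set.mem_symmDiff, Set.mem_union, Set.mem_inter_iff]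
        tauto
      calc _ ≤ μ.real (symmDiff t s ∪ symmDiff (f ⁻¹' t) s) := measureReal_mono hsub
        _ ≤ _ := measureReal_union_le _ _
        _ ≤ _ := by linarith
    have a1 := (abs_measureReal_sub_le_measureReal_symmDiff (μ := μ) htm.nullMeasurableSet
      hs.nullMeasurableSet).trans e1
    have a2 := (abs_measureReal_sub_le_measureReal_symmDiff (μ := μ)
      (htm.inter (hfm htm)).nullMeasurableSet hs.nullMeasurableSet).trans e3
    rw [hindep] at a2
    have b1 : μ.real s ≤ 1 := measureReal_le_one
    have b2 : μ.real t ≤ 1 := measureReal_le_one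
    have b3 : 0 ≤ μ.real s := measureReal_nonneg
    have b4 : 0 ≤ μ.real t := measureReal_nonneg
    rw [abs_le] at *
    constructor <;> nlinarith
  have h0 : μ.real s - μ.real s ^ 2 = 0 := by
    by_contra hne
    have hpos := abs_pos.2 hne
    linarith [key (|μ.real s - μ.real s ^ 2| / 8) (by positivity)]
  have h1 : μ.real s * (1 - μ.real s) = 0 := by linarith
  rcases mul_eq_zero.1 h1 with h | h
  · exact .inl ((measureReal_eq_zero_iff).1 h)
  · right
    have : (μ s).toReal = 1 := by rw [← measureReal_def]; linarith
    rwa [ENNReal.toReal_eq_one_iff] at this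

open ProbabilityTheory in
/-- Under the uniform Bernoulli measure, events depending on finitely many coordinates are
measured by counting. -/
theorem infinitePi_uniformOn_real_setOf {ι α E : Type*} [Fintype α] [DecidableEq α] [Fintype E]
    [Nonempty E] [MeasurableSpace E] [MeasurableSingletonClass E] {f : α → ι}
    (hf : f.Injective) (p : (α → E) → Prop) [DecidablePred p] :
    (Measure.infinitePi (fun _ : ι ↦ uniformOn (Set.univ : Set E))).real
        {x | p (fun a ↦ x (f a))} =
      (Fintype.card {y : α → E // p y} : ℝ) / (Fintype.card E : ℝ) ^ Fintype.card α := by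
  have hmap := Measure.map_infinitePi_infinitePi_of_inj
    (P := fun _ : ι ↦ uniformOn (Set.univ : Set E)) hf
  have hm : MeasurableSet {y : α → E | p y} := (Set.toFinite _).measurableSet
  have : {x : ι → E | p (fun a ↦ x (f a))} = (fun x a ↦ x (f a)) ⁻¹' {y | p y} := rfl
  rw [this, measureReal_def, ← Measure.map_apply (by fun_prop) hm, hmap,
    Measure.infinitePi_eq_pi, ← measureReal_def]
  have hsum := sum_measureReal_singleton
    (μ := Measure.pi (fun _ : α ↦ uniformOn (Set.univ : Set E))) (Finset.univ.filter p)
  have hsing : ∀ y : α → E, (Measure.pi (fun _ : α ↦ uniformOn (Set.univ : Set E))).real {y} =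
      ((Fintype.card E : ℝ) ^ Fintype.card α)⁻¹ := by
    intro y
    rw [measureReal_def, Measure.pi_singleton, ENNReal.toReal_prod]
    simp [uniformOn_univ]
  simp only [hsing, Finset.sum_const, nsmul_eq_mul, Finset.coe_filter, Finset.mem_univ,
    true_and] at hsum
  rw [← hsum, Fintype.card_subtype, div_eq_mul_inv]

/-- The number of matrices all of whose columns satisfy a given property. -/
theorem card_subtype_forall_column {α β E : Type*} [Fintype α] [DecidableEq α] [Fintype β]
    [DecidableEq β] [Fintype E] (p : (α → E) → Prop) [DecidablePred p] :
    Fintype.card {y : α → β → E // ∀ l, p (fun a ↦ y a l)} =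
      Fintype.card {z : α → E // p z} ^ Fintype.card β := by
  rw [← Fintype.card_fun]
  refine Fintype.card_congr (Equiv.trans ?_ (Equiv.subtypePiEquivPi (p := fun _ : β ↦ p)))
  exact (Equiv.piComm (fun (_ : α) (_ : β) ↦ E)).subtypeEquiv fun _ ↦ Iff.rfl

/-- Under the uniform Bernoulli measure on vectors, an event imposing one condition on each
component has as measure a power of the probability of that condition. -/
theorem infinitePi_uniformOn_real_setOf_forall {ι α β E : Type*} [Fintype α] [DecidableEq α]
    [Fintype β] [DecidableEq β] [Fintype E] [Nonempty E] [MeasurableSpace E]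
    [MeasurableSingletonClass E] {f : α → ι} (hf : f.Injective) (p : (α → E) → Prop)
    [DecidablePred p] :
    (Measure.infinitePi (fun _ : ι ↦ ProbabilityTheory.uniformOn (Set.univ : Set (β → E)))).real
        {x | ∀ l, p (fun a ↦ x (f a) l)} =
      ((Fintype.card {z : α → E // p z} : ℝ) / (Fintype.card E : ℝ) ^ Fintype.card α) ^
        Fintype.card β := by
  refine (infinitePi_uniformOn_real_setOf hf fun y : α → β → E ↦ ∀ l, p fun a ↦ y a l).trans ?_
  rw [card_subtype_forall_column, Fintype.card_fun, div_pow, Nat.cast_pow, Nat.cast_pow,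
    pow_right_comm]

/-- Translation of the `i`-th copy of `ℤ` by `v i`, acting on configurations. -/
def multiShift {κ : Type*} (E : Type*) [MeasurableSpace E] (v : κ → ℤ) :
    (κ × ℤ → E) ≃ᵐ (κ × ℤ → E) where
  toFun x p := x (p.1, p.2 + v p.1)
  invFun x p := x (p.1, p.2 - v p.1)
  left_inv x := by simp
  right_inv x := by simp
  measurable_toFun := by
    change Measurable fun (x : κ × ℤ → E) (p : κ × ℤ) ↦ x (p.1, p.2 + v p.1)
    fun_prop
  measurable_invFun := by
    change Measurable fun (x : κ × ℤ → E) (p : κ × ℤ) ↦ x (p.1, p.2 - v p.1)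
    fun_prop

theorem multiShift_apply {κ E : Type*} [MeasurableSpace E] (v : κ → ℤ) (x : κ × ℤ → E)
    (p : κ × ℤ) : multiShift E v x p = x (p.1, p.2 + v p.1) := rfl

theorem multiShift_zpow {κ E : Type*} [MeasurableSpace E] (v : κ → ℤ) (n : ℤ) :
    (multiShift E v).toEquiv ^ n = (multiShift E (n • v)).toEquiv := by
  have hadd (v w : κ → ℤ) : (multiShift E (v + w)).toEquiv =
      (multiShift E v).toEquiv * (multiShift E w).toEquiv := by
    ext x p
    change x _ = x _
    simp only [Pi.add_apply]
    congr 2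
    ring
  let φ : Multiplicative (κ → ℤ) →* Equiv.Perm (κ × ℤ → E) :=
    MonoidHom.mk' (fun v ↦ (multiShift E v.toAdd).toEquiv) fun v w ↦ hadd _ _
  exact (map_zpow φ (Multiplicative.ofAdd v) n).symm

theorem mem_multiShift_zpow_image {κ E : Type*} [MeasurableSpace E] (v : κ → ℤ) (n : ℤ)
    (A : Set (κ × ℤ → E)) (x : κ × ℤ → E) :
    x ∈ ⇑((multiShift E v).toEquiv ^ n) '' A ↔ (fun p ↦ x (p.1, p.2 - n * v p.1)) ∈ A := by
  rw [multiShift_zpow, Equiv.image_eq_preimage_symm]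
  rfl

theorem measurePreserving_multiShift {κ E : Type*} [MeasurableSpace E] (P : Measure E)
    [IsProbabilityMeasure P] (v : κ → ℤ) :
    MeasurePreserving (multiShift E v) (Measure.infinitePi fun _ ↦ P)
      (Measure.infinitePi fun _ ↦ P) := by
  refine ⟨(multiShift E v).measurable,
    Measure.map_infinitePi_infinitePi_of_inj (P := fun _ : κ × ℤ ↦ P)
      (f := fun p : κ × ℤ ↦ (p.1, p.2 + v p.1)) ?_⟩
  rintro ⟨i, a⟩ ⟨j, b⟩ h
  obtain ⟨rfl, h⟩ := Prod.mk.inj h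
  simpa using h

/-- A shift moving every copy of `ℤ` in the positive direction is ergodic. -/
theorem measure_eq_zero_or_one_of_multiShift_invariant {κ E : Type*} [MeasurableSpace E]
    (P : Measure E) [IsProbabilityMeasure P] {v : κ → ℤ} (hv : ∀ i, 0 < v i)
    {s : Set (κ × ℤ → E)} (hs : MeasurableSet s) (h : multiShift E v ⁻¹' s = s) :
    Measure.infinitePi (fun _ ↦ P) s = 0 ∨ Measure.infinitePi (fun _ ↦ P) s = 1 := by
  refine measure_infinitePi_eq_zero_or_one_of_invariant P hs fun I ↦ ?_
  obtain ⟨N, hN⟩ : ∃ N : ℕ, ∀ p ∈ I, p.2.natAbs ≤ N :=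
    ⟨I.sup fun p ↦ p.2.natAbs, fun p hp ↦ Finset.le_sup (f := fun p ↦ p.2.natAbs) hp⟩
  refine ⟨fun p ↦ (p.1, p.2 + (2 * N + 1 : ℕ) * v p.1), ?_, ?_, ?_⟩
  · rintro ⟨i, a⟩ ⟨j, b⟩ h
    obtain ⟨rfl, h⟩ := Prod.mk.inj h
    simpa using h
  · intro p hp hp'
    have h1 := hN _ hp
    have h2 := hN _ hp'
    have h3 : (2 * N + 1 : ℤ) ≤ (2 * N + 1 : ℕ) * v p.1 := by
      push_cast
      nlinarith [hv p.1]
    simp only at h2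
    omega
  · have hiter (n : ℕ) : (fun (x : κ × ℤ → E) (p : κ × ℤ) ↦ x (p.1, p.2 + n * v p.1)) =
        (multiShift E v)^[n] := by
      induction n with
      | zero => ext x; simp
      | succ n ih =>
        rw [Function.iterate_succ', ← ih]
        ext x p
        simp only [Function.comp_apply, multiShift_apply]
        congr 2
        push_cast
        ring
    rw [hiter, Set.preimage_iterate_eq]
    exact Function.iterate_fixed h _

/-- The lines `x, x + a, x + a + a` of `ℤ/3` with `a ∈ {0, 1}`. -/
def IsShortLine (x y z : Fin 3) : Prop :=
  (y = x ∧ z = x) ∨ (y = x + 1 ∧ z = x + 2)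

instance (x y z : Fin 3) : Decidable (IsShortLine x y z) :=
  inferInstanceAs (Decidable (_ ∨ _))

theorem card_isShortLine :
    Fintype.card {z : Fin 3 → Fin 3 // IsShortLine (z 0) (z 1) (z 2)} = 6 := by
  decide +kernel

theorem card_isShortLine_corner :
    Fintype.card {z : Fin 3 × Fin 2 → Fin 3 // IsShortLine (z (0, 0)) (z (1, 0)) (z (2, 0)) ∧
      IsShortLine (z (0, 0)) (z (1, 1)) (z (2, 1)) ∧
      IsShortLine (z (0, 1)) (z (1, 0)) (z (2, 1))} = 6 := by
  decide +kernel

theorem counterexample_exponent_three (c : ℝ) (hc0 : 0 < c) (hc1 : c ≤ 1) :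
    ∃ (X : Type) (_ : MeasurableSpace X) (μ : Measure X) (T₁ T₂ : X ≃ᵐ X),
      IsProbabilityMeasure μ ∧
      MeasurePreserving T₁ μ μ ∧ MeasurePreserving T₂ μ μ ∧
      (∀ x, T₁ (T₂ x) = T₂ (T₁ x)) ∧
      (∀ s : Set X, MeasurableSet s → T₁ ⁻¹' s = s → T₂ ⁻¹' s = s →
        μ s = 0 ∨ μ s = 1) ∧
      ∃ A : Set X, MeasurableSet A ∧ 0 < μ A ∧
        ∀ n : ℤ, n ≠ 0 →
          (μ (A ∩ ⇑(T₁.toEquiv ^ n) '' A ∩ ⇑(T₂.toEquiv ^ n) '' A)).toReal <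
            c * (μ A).toReal ^ 3 := by
  obtain ⟨k, hk⟩ := exists_pow_lt_of_lt_one hc0 (show (3 / 4 : ℝ) < 1 by norm_num)
  let E := Fin k → Fin 3
  let P : Measure E := ProbabilityTheory.uniformOn Set.univ
  let v₁ : Fin 3 → ℤ := ![0, 1, 1]
  let v₂ : Fin 3 → ℤ := ![1, 0, 1]
  let A : Set (Fin 3 × ℤ → E) := {x | ∀ l, IsShortLine (x (0, 0) l) (x (1, 0) l) (x (2, 0) l)}
  have hA : (Measure.infinitePi fun _ : Fin 3 × ℤ ↦ P).real A = (6 / 27) ^ k := by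
    have h := infinitePi_uniformOn_real_setOf_forall (ι := Fin 3 × ℤ) (β := Fin k)
      (f := fun i : Fin 3 ↦ (i, (0 : ℤ))) (fun i j h ↦ (Prod.mk.inj h).1)
      (fun z ↦ IsShortLine (z 0) (z 1) (z 2))
    rw [card_isShortLine] at h
    refine h.trans ?_
    norm_num
  refine ⟨Fin 3 × ℤ → E, inferInstance, Measure.infinitePi fun _ ↦ P, multiShift E v₁,
    multiShift E v₂, inferInstance, measurePreserving_multiShift P v₁,
    measurePreserving_multiShift P v₂, ?_, ?_, A, ?_, ?_, ?_⟩
  · intro x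
    ext1 p
    simp only [multiShift_apply, add_right_comm]
  · intro s hs h₁ h₂
    refine measure_eq_zero_or_one_of_multiShift_invariant P (v := v₁ + v₂) ?_ hs ?_
    · intro i
      fin_cases i <;> simp [v₁, v₂]
    · have hcomp : ⇑(multiShift E (v₁ + v₂)) = multiShift E v₁ ∘ multiShift E v₂ := by
        ext x p : 2
        simp only [Function.comp_apply, multiShift_apply, Pi.add_apply, add_assoc]
      rw [hcomp, Set.preimage_comp, h₁, h₂]
  · have : A = (fun (x : Fin 3 × ℤ → E) (i : Fin 3) ↦ x (i, 0)) ⁻¹'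
        {y | ∀ l, IsShortLine (y 0 l) (y 1 l) (y 2 l)} := rfl
    rw [this]
    exact measurableSet_preimage (by fun_prop) (Set.toFinite _).measurableSet
  · refine pos_iff_ne_zero.2 fun h0 ↦ ?_
    rw [measureReal_def, h0, ENNReal.toReal_zero] at hA
    exact (pow_pos (by norm_num) k).ne hA
  · intro n hn
    simp only [← measureReal_def]
    have h := infinitePi_uniformOn_real_setOf_forall (ι := Fin 3 × ℤ) (β := Fin k)
      (f := fun p : Fin 3 × Fin 2 ↦ (p.1, -n * (p.2 : ℕ))) (by
        rintro ⟨i, a⟩ ⟨j, b⟩ h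
        obtain ⟨rfl, h⟩ := Prod.mk.inj h
        have h' := mul_left_cancel₀ (neg_ne_zero.2 hn) h
        rw [Prod.mk.injEq]
        exact ⟨rfl, Fin.ext (by exact_mod_cast h')⟩)
      (fun z ↦ IsShortLine (z (0, 0)) (z (1, 0)) (z (2, 0)) ∧
        IsShortLine (z (0, 0)) (z (1, 1)) (z (2, 1)) ∧
        IsShortLine (z (0, 1)) (z (1, 0)) (z (2, 1)))
    rw [card_isShortLine_corner] at h
    have hset : A ∩ ⇑((multiShift E v₁).toEquiv ^ n) '' A ∩ ⇑((multiShift E v₂).toEquiv ^ n) '' A =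
        {x | ∀ l, IsShortLine (x (0, 0) l) (x (1, 0) l) (x (2, 0) l) ∧
          IsShortLine (x (0, 0) l) (x (1, -n) l) (x (2, -n) l) ∧
          IsShortLine (x (0, -n) l) (x (1, 0) l) (x (2, -n) l)} := by
      ext x
      rw [Set.mem_inter_iff, Set.mem_inter_iff, mem_multiShift_zpow_image,
        mem_multiShift_zpow_image]
      simp [A, v₁, v₂, forall_and, and_assoc]
    simp only [Fin.val_zero, Fin.val_one, Nat.cast_zero, Nat.cast_one, mul_zero, mul_one] at h
    rw [hset, hA]
    refine h.trans_lt ?_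
    have hpow : (6 / 3 ^ 6 : ℝ) ^ k = (3 / 4) ^ k * ((6 / 27) ^ k) ^ 3 := by
      rw [pow_right_comm, ← mul_pow]
      norm_num
    simp only [Fintype.card_fin, Fintype.card_prod]
    push_cast
    rw [hpow]
    gcongr
end
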